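/- arXiv:1101.1946 — 4 statements merged into one kernel-verified Lean document; each statement's English description precedes it below -/
import Mathlib

section
/- Let p be an odd prime. Then ∑_{k=0}^{p-1} A_k ≡ c(p) (mod p), where c(p) = 4x² - 2p if p ≡ 1 or 3 (mod 8) and p = x² + 2y² with x, y integers, and c(p) = 0 if p ≡ 5 or 7 (mod 8). -/
/-- The Apéry number `A_n = ∑_{k=0}^n C(n,k)² C(n+k,k)²`. -/
def aperyNum (n : ℕ) : ℤ :=
  ∑ k ∈ Finset.range (n + 1), (n.choose k : ℤ) ^ 2 * ((n + k).choose k : ℤ) ^ 2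

section
open Finset

theorem cast_choose_succ_mul {R : Type*} [CommRing R] (n k : ℕ) :
    (n.choose (k + 1) : R) * (k + 1) = n.choose k * (n - k) := by
  rcases le_or_gt k n with h | h
  · have := congrArg (Nat.cast (R := R)) (Nat.choose_succ_right_eq n k)
    push_cast [Nat.cast_sub h] at this
    exact this
  · simp [Nat.choose_eq_zero_of_lt h, Nat.choose_eq_zero_of_lt (h.trans k.lt_succ_self)]

/-- The Legendre-type basis `C(n,k) C(n+k,k)` of the polynomials in `n (n + 1)`. -/
def chooseProd (k n : ℕ) : ℤ := n.choose k * (n + k).choose k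

theorem succ_sq_mul_chooseProd_succ (k n : ℕ) :
    ((k : ℤ) + 1) ^ 2 * chooseProd (k + 1) n = (n * (n + 1) - k * (k + 1)) * chooseProd k n := by
  have h1 := cast_choose_succ_mul (R := ℤ) n k
  have h2 : ((n : ℤ) + k + 1) * (n + k).choose k = (n + (k + 1)).choose (k + 1) * (k + 1) := by
    exact_mod_cast Nat.add_one_mul_choose_eq (n + k) k
  unfold chooseProd
  linear_combination ((k : ℤ) + 1) * (n + (k + 1)).choose (k + 1) * h1
    - (n.choose k : ℤ) * (n - k) * h2

theorem linearization_coeff_succ (j k l : ℕ) :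
    ((j : ℤ) + 1) ^ 2 * ((l + 1).choose (j + 1) * (l + 1).choose k * (j + 1 + k).choose (l + 1)) =
      ((l : ℤ) + 1) ^ 2 * (l.choose j * l.choose k * (j + k).choose l) +
      (((l : ℤ) + 1) * (l + 2) - j * (j + 1)) *
        ((l + 1).choose j * (l + 1).choose k * (j + k).choose (l + 1)) := by
  have key : ∀ i : ℕ, ((l : ℤ) + 1) * l.choose i = (l + 1 - i) * (l + 1).choose i := by
    intro i
    have h1 := cast_choose_succ_mul (R := ℤ) (l + 1) i
    have h2 : ((l : ℤ) + 1) * l.choose i = (l + 1).choose (i + 1) * (i + 1) := by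
      exact_mod_cast Nat.add_one_mul_choose_eq l i
    push_cast at h1
    linear_combination h1 + h2
  have hj : ((l : ℤ) + 1) * l.choose j = (l + 1).choose (j + 1) * (j + 1) := by
    exact_mod_cast Nat.add_one_mul_choose_eq l j
  have hd := cast_choose_succ_mul (R := ℤ) (j + k) l
  have hp : ((j + 1 + k).choose (l + 1) : ℤ) = (j + k).choose l + (j + k).choose (l + 1) := by
    rw [show j + 1 + k = (j + k) + 1 by ring, Nat.choose_succ_succ]; push_cast; ring
  have h1 := key j
  have h2 := key k
  rw [hp]
  push_cast at hd
  generalize ((l + 1).choose (j + 1) : ℤ) = x at *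
  generalize ((l + 1).choose j : ℤ) = A at *
  generalize ((l + 1).choose k : ℤ) = B at *
  generalize (l.choose j : ℤ) = a at *
  generalize (l.choose k : ℤ) = b at *
  generalize ((j + k).choose l : ℤ) = d at *
  generalize ((j + k).choose (l + 1) : ℤ) = D at *
  linear_combination (-(j + 1) * B * (d + D)) * hj + ((j : ℤ) + 1) * B * (d + D) * h1
    - d * (l + 1) * b * h1 - d * (l + 1 - j) * A * h2 - (l + 1 - j) * A * B * hd

theorem chooseProd_mul_chooseProd (j k n : ℕ) :
    chooseProd j n * chooseProd k n = ∑ l ∈ range (j + k + 1),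
      (l.choose j * l.choose k * (j + k).choose l : ℤ) * chooseProd l n := by
  induction j with
  | zero =>
    rw [Finset.sum_eq_single k]
    · simp [chooseProd]
    · intro l hl hlk
      rw [mem_range] at hl
      have : l < k := by omega
      simp [Nat.choose_eq_zero_of_lt this]
    · simp
  | succ j ih =>
    have hne : ((j : ℤ) + 1) ^ 2 ≠ 0 := by positivity
    apply mul_left_cancel₀ hne
    have e1 : ((j : ℤ) + 1) ^ 2 * (chooseProd (j + 1) n * chooseProd k n) =
        (n * (n + 1) - j * (j + 1)) * (chooseProd j n * chooseProd k n) := by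
      linear_combination chooseProd k n * succ_sq_mul_chooseProd_succ j n
    have e2 : (n * (n + 1) - j * (j + 1)) * (∑ l ∈ range (j + k + 1),
        (l.choose j * l.choose k * (j + k).choose l : ℤ) * chooseProd l n) =
        ∑ l ∈ range (j + k + 1), ((l : ℤ) + 1) ^ 2 *
          (l.choose j * l.choose k * (j + k).choose l : ℤ) * chooseProd (l + 1) n +
        ∑ l ∈ range (j + k + 2), ((l : ℤ) * (l + 1) - j * (j + 1)) *
          (l.choose j * l.choose k * (j + k).choose l : ℤ) * chooseProd l n := by
      rw [sum_range_succ _ (j + k + 1), Nat.choose_eq_zero_of_lt (Nat.lt_succ_self (j + k)),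
        mul_sum]
      simp only [Nat.cast_zero, mul_zero, zero_mul, add_zero]
      rw [← sum_add_distrib]
      refine sum_congr rfl fun l _ => ?_
      linear_combination
        -(l.choose j * l.choose k * (j + k).choose l : ℤ) * succ_sq_mul_chooseProd_succ l n
    rw [e1, ih, e2, sum_range_succ' _ (j + k + 1), show j + 1 + k + 1 = (j + k + 1) + 1 by ring,
      sum_range_succ' _ (j + k + 1)]
    have h0 : (((0 : ℕ) : ℤ) * ((0 : ℕ) + 1) - j * (j + 1)) *
        ((0 : ℕ).choose j * (0 : ℕ).choose k * (j + k).choose 0 : ℤ) = 0 := by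
      cases j <;> simp
    rw [h0]
    simp only [Nat.choose_zero_succ, Nat.cast_zero, zero_mul, add_zero]
    rw [← sum_add_distrib, mul_sum]
    refine sum_congr rfl fun l _ => ?_
    have := linearization_coeff_succ j k l
    push_cast
    linear_combination -chooseProd (l + 1) n * this

theorem sum_range_chooseProd (l N : ℕ) :
    ∑ n ∈ range N, chooseProd l n = (2 * l).choose l * (N + l).choose (2 * l + 1) := by
  induction N with
  | zero => simp [Nat.choose_eq_zero_of_lt (show l < 2 * l + 1 by omega)]
  | succ N ih =>
    rw [sum_range_succ, ih, show N + 1 + l = (N + l) + 1 by ring, Nat.choose_succ_succ (N + l)]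
    rcases le_or_gt l N with h | h
    · have := Nat.choose_mul (n := N + l) (k := 2 * l) (s := l) (by omega)
      rw [show 2 * l - l = l by omega, Nat.add_sub_cancel] at this
      have h' : ((N + l).choose (2 * l) * (2 * l).choose l : ℤ) =
        (N + l).choose l * N.choose l := by exact_mod_cast this
      unfold chooseProd
      push_cast
      linear_combination -h'
    · simp [chooseProd, Nat.choose_eq_zero_of_lt h,
        Nat.choose_eq_zero_of_lt (show N + l < 2 * l by omega)]

theorem choose_mul_choose_eq {m k : ℕ} (hk : k ≤ m) (i : ℕ) :
    m.choose k * k.choose i = m.choose i * (m - i).choose (m - k) := by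
  rcases le_or_gt i k with h | h
  · rw [Nat.choose_mul h, ← Nat.choose_symm (show k - i ≤ m - i by omega),
      show m - i - (k - i) = m - k by omega]
  · rw [Nat.choose_eq_zero_of_lt h]
    rcases le_or_gt i m with h' | h'
    · rw [Nat.choose_eq_zero_of_lt (show m - i < m - k by omega)]; simp
    · rw [Nat.choose_eq_zero_of_lt h']; simp

theorem sum_choose_mul_choose_eq {m j : ℕ} (hj : j ≤ m) :
    ∑ i ∈ range (m + 1), (m - j).choose i * j.choose i = m.choose j := by
  conv_rhs => rw [show m = (m - j) + j by omega, Nat.add_choose_eq,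
    Nat.sum_antidiagonal_eq_sum_range_succ_mk]
  rw [← sum_subset (range_mono (show j + 1 ≤ m + 1 by omega))]
  · refine sum_congr rfl fun i hi => ?_
    rw [mem_range, Nat.lt_succ_iff] at hi
    rw [Nat.choose_symm hi]
  · intro i _ hi
    rw [mem_range, not_lt] at hi
    rw [Nat.choose_eq_zero_of_lt (show j < i by omega), mul_zero]

theorem sum_choose_sq_mul_choose_two_mul (m : ℕ) :
    ∑ k ∈ range (m + 1), m.choose k ^ 2 * (2 * k).choose m =
      ∑ j ∈ range (m + 1), m.choose j ^ 3 := by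
  have h1 : ∀ k, (2 * k).choose m = ∑ j ∈ range (m + 1), k.choose j * k.choose (m - j) := by
    intro k
    rw [two_mul, Nat.add_choose_eq, Nat.sum_antidiagonal_eq_sum_range_succ_mk]
  simp_rw [h1, mul_sum]
  rw [sum_comm]
  refine sum_congr rfl fun j hj => ?_
  rw [mem_range, Nat.lt_succ_iff] at hj
  have h2 : m.choose j ^ 3 =
      ∑ i ∈ range (m + 1), m.choose j ^ 2 * ((m - j).choose i * j.choose i) := by
    rw [← mul_sum, sum_choose_mul_choose_eq hj, pow_succ]
  rw [h2, ← sum_range_reflect]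
  refine sum_congr rfl fun i hi => ?_
  rw [mem_range] at hi
  have hk : m + 1 - 1 - i ≤ m := by omega
  have e1 := choose_mul_choose_eq hk j
  have e2 := choose_mul_choose_eq hk (m - j)
  rw [show m - (m + 1 - 1 - i) = i by omega] at e1 e2
  rw [Nat.choose_symm hj, show m - (m - j) = j by omega] at e2
  calc _ = (m.choose (m + 1 - 1 - i) * (m + 1 - 1 - i).choose j) *
        (m.choose (m + 1 - 1 - i) * (m + 1 - 1 - i).choose (m - j)) := by ring
    _ = _ := by rw [e1, e2]; ring

theorem aperyNum_eq_sum {n N : ℕ} (h : n < N) :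
    aperyNum n = ∑ k ∈ range N, chooseProd k n * chooseProd k n := by
  unfold aperyNum
  rw [← sum_subset (range_mono (show n + 1 ≤ N by omega))]
  · refine sum_congr rfl fun k _ => ?_
    unfold chooseProd; ring
  · intro k _ hk
    rw [mem_range, not_lt] at hk
    simp [chooseProd, Nat.choose_eq_zero_of_lt (show n < k by omega)]

theorem natCast_ne_zero_of_lt {p j : ℕ} (h0 : 0 < j) (h : j < p) : (j : ZMod p) ≠ 0 := by
  rw [Ne, ZMod.natCast_eq_zero_iff]
  exact Nat.not_dvd_of_pos_of_lt h0 h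

theorem natCast_succ_ne_zero {p j : ℕ} (h : j + 1 < p) : (j : ZMod p) + 1 ≠ 0 := by
  exact_mod_cast natCast_ne_zero_of_lt j.succ_pos h

theorem cast_choose_mul_factorial {R : Type*} [CommRing R] (n k : ℕ) :
    (n.choose k : R) * k.factorial = ∏ i ∈ range k, ((n : R) - i) := by
  induction k with
  | zero => simp
  | succ k ih =>
    rw [prod_range_succ, ← ih, Nat.factorial_succ]
    push_cast
    linear_combination (k.factorial : R) * cast_choose_succ_mul (R := R) n k

/-- Reflection of the upper entry: `C(a,k) = (-1)^k C(k-1-a,k)`, read modulo `p`. -/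
theorem choose_eq_neg_one_pow_mul_choose {p : ℕ} [Fact p.Prime] {a b k : ℕ} (hk : k < p)
    (h : ((a + b + 1 : ℕ) : ZMod p) = k) :
    (a.choose k : ZMod p) = (-1) ^ k * b.choose k := by
  have hf : (k.factorial : ZMod p) ≠ 0 := by
    rw [Ne, ZMod.natCast_eq_zero_iff, (Fact.out : p.Prime).dvd_factorial, not_le]
    exact hk
  apply mul_right_cancel₀ hf
  rw [mul_assoc, cast_choose_mul_factorial, cast_choose_mul_factorial, ← prod_range_reflect]
  conv_rhs => rw [← card_range k, ← prod_const, card_range, ← prod_mul_distrib]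
  refine prod_congr rfl fun i hi => ?_
  rw [mem_range] at hi
  push_cast [show k - 1 - i = k - (i + 1) by omega, Nat.cast_sub (show i + 1 ≤ k by omega)]
  push_cast at h
  linear_combination h

theorem two_mul_add_one_eq_zero {p m : ℕ} (hm : p = 2 * m + 1) : (2 * m + 1 : ZMod p) = 0 := by
  have h := congrArg (Nat.cast (R := ZMod p)) hm
  push_cast at h
  rw [← h, ZMod.natCast_self]

theorem two_ne_zero_modp {p m : ℕ} [Fact p.Prime] (hm : p = 2 * m + 1) : (2 : ZMod p) ≠ 0 := by
  have := natCast_ne_zero_of_lt (p := p) (j := 2) (by norm_num)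
    (by have := (Fact.out : p.Prime).two_le; omega)
  exact_mod_cast this

theorem choose_two_mul_self_eq {p m : ℕ} [Fact p.Prime] (hm : p = 2 * m + 1) {j : ℕ}
    (hj : j < p) : ((2 * j).choose j : ZMod p) = (-4) ^ j * m.choose j := by
  have hm' := two_mul_add_one_eq_zero hm
  induction j with
  | zero => simp
  | succ j ih =>
    apply mul_left_cancel₀ (natCast_succ_ne_zero hj)
    have h1 := Nat.succ_mul_centralBinom_succ j
    rw [Nat.centralBinom, Nat.centralBinom] at h1
    have h2 := congrArg (Nat.cast (R := ZMod p)) h1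
    have h3 := cast_choose_succ_mul (R := ZMod p) m j
    push_cast at h2
    rw [ih (by omega)] at h2
    rw [pow_succ]
    linear_combination h2 + 4 * (-4) ^ j * h3 + 2 * (-4) ^ j * (m.choose j : ZMod p) * hm'

theorem sum_range_chooseProd_modp {p m l : ℕ} [Fact p.Prime] (hm : p = 2 * m + 1) (hl : l < p) :
    ((∑ n ∈ range p, chooseProd l n : ℤ) : ZMod p) = if l = m then (-1) ^ m else 0 := by
  rw [sum_range_chooseProd]
  push_cast
  have L : ∀ n k : ℕ, (n.choose k : ZMod p) =
      ((n % p).choose (k % p) * (n / p).choose (k / p) : ℕ) := fun n k =>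
    (ZMod.natCast_eq_natCast_iff _ _ _).2 Choose.choose_modEq_choose_mod_mul_choose_div_nat
  have hp0 : 0 < p := by omega
  split_ifs with h
  · subst h
    rw [L (p + l), ← hm, Nat.mod_self, Nat.add_mod_left, Nat.mod_eq_of_lt hl, Nat.div_self hp0,
      Nat.add_div_left _ hp0, Nat.div_eq_of_lt hl,
      choose_eq_neg_one_pow_mul_choose (b := l) hl (by
        rw [show 2 * l + l + 1 = l + (2 * l + 1) by ring, ← hm]; simp)]
    simp
  · rcases lt_or_gt_of_ne h with h | h
    · rw [L (p + l), Nat.add_mod_left, Nat.mod_eq_of_lt hl,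
        Nat.mod_eq_of_lt (show 2 * l + 1 < p by omega),
        Nat.choose_eq_zero_of_lt (show l < 2 * l + 1 by omega)]
      simp
    · rw [L (2 * l), Nat.mod_eq_of_lt hl, show 2 * l = p + (2 * l - p) by omega, Nat.add_mod_left,
        Nat.mod_eq_of_lt (show 2 * l - p < p by omega),
        Nat.choose_eq_zero_of_lt (show 2 * l - p < l by omega)]
      simp

theorem sum_aperyNum_modp {p m : ℕ} [Fact p.Prime] (hm : p = 2 * m + 1) :
    ((∑ n ∈ range p, aperyNum n : ℤ) : ZMod p) =
      (-1) ^ m * ∑ j ∈ range (m + 1), (m.choose j : ZMod p) ^ 3 := by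
  have h1 : ∑ n ∈ range p, aperyNum n = ∑ k ∈ range p, ∑ l ∈ range p,
      (l.choose k * l.choose k * (k + k).choose l : ℤ) * ∑ n ∈ range p, chooseProd l n := by
    rw [sum_congr rfl fun n hn => aperyNum_eq_sum (mem_range.1 hn), sum_comm]
    refine sum_congr rfl fun k _ => ?_
    simp_rw [mul_sum]
    rw [sum_comm]
    refine sum_congr rfl fun n hn => ?_
    rw [mem_range] at hn
    rw [chooseProd_mul_chooseProd]
    have hz1 : ∀ l, l ∉ range (k + k + 1) →
        (l.choose k * l.choose k * (k + k).choose l : ℤ) * chooseProd l n = 0 := by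
      intro l hl
      rw [mem_range, not_lt] at hl
      simp [Nat.choose_eq_zero_of_lt (show k + k < l by omega)]
    have hz2 : ∀ l, l ∉ range p →
        (l.choose k * l.choose k * (k + k).choose l : ℤ) * chooseProd l n = 0 := by
      intro l hl
      rw [mem_range, not_lt] at hl
      simp [chooseProd, Nat.choose_eq_zero_of_lt (show n < l by omega)]
    rw [sum_subset subset_union_left fun l _ hl => hz1 l hl,
      sum_subset subset_union_right fun l _ hl => hz2 l hl]
  have h2 := congrArg (Nat.cast (R := ZMod p)) (sum_choose_sq_mul_choose_two_mul m)
  push_cast at h2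
  rw [h1, ← h2, sum_subset (range_mono (show m + 1 ≤ p by omega))
    (fun k _ hk => by
      rw [mem_range, not_lt] at hk
      simp [Nat.choose_eq_zero_of_lt (show m < k by omega)]), mul_sum]
  rw [Int.cast_sum]
  refine sum_congr rfl fun k _ => ?_
  rw [Int.cast_sum, sum_eq_single m]
  · rw [Int.cast_mul, sum_range_chooseProd_modp hm (by omega), if_pos rfl]
    push_cast
    rw [← two_mul]
    ring
  · intro l hl hlm
    rw [Int.cast_mul, sum_range_chooseProd_modp hm (mem_range.1 hl), if_neg hlm, mul_zero]
  · intro h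
    exact absurd (mem_range.2 (by omega)) h

open Polynomial in
/-- The polynomial `∑ C(r,i)² X^i`. -/
noncomputable def chooseSqPoly (R : Type*) [CommRing R] (r : ℕ) : R[X] :=
  ∑ i ∈ range (r + 1), C ((r.choose i : R) ^ 2) * X ^ i

section
variable {R : Type*} [CommRing R]

theorem chooseSqPoly_coeff (r n : ℕ) : (chooseSqPoly R r).coeff n = (r.choose n : R) ^ 2 := by
  simp only [chooseSqPoly, Polynomial.finsetSum_coeff, Polynomial.coeff_C_mul_X_pow]
  rw [sum_ite_eq]
  split_ifs with h
  · rfl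
  · rw [mem_range, not_lt] at h
    simp [Nat.choose_eq_zero_of_lt (show r < n by omega)]

theorem natDegree_chooseSqPoly_le (r : ℕ) : (chooseSqPoly R r).natDegree ≤ r := by
  rw [Polynomial.natDegree_le_iff_coeff_eq_zero]
  intro n hn
  simp [chooseSqPoly_coeff, Nat.choose_eq_zero_of_lt hn]

theorem chooseSqPoly_sq_coeff (r n : ℕ) : (chooseSqPoly R r ^ 2).coeff n =
    ∑ i ∈ range (n + 1), (r.choose i : R) ^ 2 * (r.choose (n - i) : R) ^ 2 := by
  rw [sq, Polynomial.coeff_mul, Nat.sum_antidiagonal_eq_sum_range_succ_mk]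
  simp only [chooseSqPoly_coeff]

theorem chooseSqPoly_sq_coeff_two_mul (r : ℕ) : (chooseSqPoly R r ^ 2).coeff (2 * r) = 1 := by
  rw [chooseSqPoly_sq_coeff, sum_eq_single r]
  · simp [show 2 * r - r = r by omega]
  · intro i _ hi
    rcases lt_or_gt_of_ne hi with h | h
    · simp [Nat.choose_eq_zero_of_lt (show r < 2 * r - i by omega)]
    · simp [Nat.choose_eq_zero_of_lt h]
  · intro h
    exact absurd (mem_range.2 (by omega)) h

/-- Clausen's formula at `a = b = 1/4`, as a recurrence for the coefficients of the square. -/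
theorem chooseSqPoly_sq_coeff_succ {r : ℕ} (hr : (4 * r + 1 : R) = 0) (n : ℕ) :
    16 * (((n : R) + 1) ^ 3 * (chooseSqPoly R r ^ 2).coeff (n + 1)) =
      2 * ((2 * n + 1) ^ 3 * (chooseSqPoly R r ^ 2).coeff n) := by
  set w : ℕ → R := fun i => (r.choose i : R) ^ 2 with hw
  have hrec : ∀ i : ℕ, 16 * ((i : R) + 1) ^ 2 * w (i + 1) = (4 * i + 1) ^ 2 * w i := by
    intro i
    have h := cast_choose_succ_mul (R := R) r i
    simp only [hw]
    linear_combination 16 * ((r.choose (i + 1) : R) * (i + 1) + r.choose i * (r - i)) * h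
      + (r.choose i : R) ^ 2 * (4 * r - 8 * i - 1) * hr
  simp only [chooseSqPoly_sq_coeff]
  set G : ℕ → R := fun i => 16 * (i : R) ^ 2 * (2 * i - 3 * (n + 1)) * w i * w (n + 1 - i) with hG
  have step : ∀ i ∈ range (n + 1), 16 * ((n : R) + 1) ^ 3 * (w i * w (n + 1 - i)) -
      2 * (2 * n + 1) ^ 3 * (w i * w (n - i)) = G (i + 1) - G i := by
    intro i hi
    rw [mem_range, Nat.lt_succ_iff] at hi
    obtain ⟨j, rfl⟩ := Nat.exists_eq_add_of_le hi
    have h1 := hrec i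
    have h2 := hrec j
    simp only [hG]
    rw [show i + j + 1 - i = j + 1 by omega, show i + j - i = j by omega,
      show i + j + 1 - (i + 1) = j by omega]
    push_cast
    linear_combination w i * (i + j + 1 + 2 * i) * h2 -
      (2 * ((i : R) + 1) - 3 * (i + j + 1)) * w j * h1
  have tel := sum_range_sub G (n + 1)
  rw [← sum_congr rfl step, sum_sub_distrib, ← mul_sum, ← mul_sum] at tel
  rw [sum_range_succ _ (n + 1)]
  have e1 : G 0 = 0 := by simp [hG]
  have e2 : G (n + 1) = -16 * (n + 1) ^ 3 * (w (n + 1) * w (n + 1 - (n + 1))) := by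
    simp only [hG]; push_cast; ring
  rw [e1, e2] at tel
  linear_combination tel

theorem eval_chooseSqPoly_neg_one_of_odd {r : ℕ} (hr : Odd r) :
    2 * (chooseSqPoly R r).eval (-1) = 0 := by
  simp only [chooseSqPoly, Polynomial.eval_finsetSum, Polynomial.eval_mul, Polynomial.eval_C,
    Polynomial.eval_pow, Polynomial.eval_X]
  rw [two_mul]
  nth_rw 2 [← sum_range_reflect]
  rw [← sum_add_distrib]
  refine sum_eq_zero fun i hi => ?_
  rw [mem_range] at hi
  rw [show r + 1 - 1 - i = r - i by omega, Nat.choose_symm (by omega)]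
  have : (-1 : R) ^ (r - i) = -(-1) ^ i := by
    rcases Nat.even_or_odd i with h | h
    · rw [h.neg_one_pow, (Nat.Odd.sub_even (by omega) hr h).neg_one_pow]
    · rw [h.neg_one_pow, (Nat.Odd.sub_odd hr h).neg_one_pow, neg_neg]
  rw [this]; ring

open Polynomial in
theorem eval_chooseSqPoly_neg_one_two_mul (k : ℕ) :
    (chooseSqPoly R (2 * k)).eval (-1) = (-1) ^ k * (2 * k).choose k := by
  simp only [chooseSqPoly, Polynomial.eval_finsetSum, Polynomial.eval_mul, Polynomial.eval_C,
    Polynomial.eval_pow, Polynomial.eval_X]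
  have hc : ∀ n i : ℕ, ((1 - X : R[X]) ^ n).coeff i = (-1) ^ i * n.choose i := by
    intro n i
    have h : (1 - X : R[X]) ^ n = ((1 + X : R[X]) ^ n).comp (C (-1) * X) := by
      simp [sub_eq_add_neg]
    rw [h, comp_C_mul_X_coeff, coeff_one_add_X_pow, mul_comm]
  have h : ((1 - X : R[X]) ^ (2 * k) * (1 + X) ^ (2 * k)).coeff (2 * k) =
      (expand R 2 ((1 - X) ^ (2 * k))).coeff (k * 2) := by
    rw [← mul_pow, mul_comm k 2]
    congr 1
    simp only [map_pow, map_sub, map_one, expand_X]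
    ring
  rw [coeff_expand_mul (by norm_num), hc, coeff_mul, Nat.sum_antidiagonal_eq_sum_range_succ_mk] at h
  rw [← h]
  refine sum_congr rfl fun i hi => ?_
  rw [mem_range] at hi
  simp only [hc, coeff_one_add_X_pow]
  rw [Nat.choose_symm (by omega)]
  ring
end

theorem eq_neg_one_pow_mul_choose_cube {p m : ℕ} [Fact p.Prime] (hm : p = 2 * m + 1)
    {u : ℕ → ZMod p}
    (hu : ∀ n : ℕ, 16 * (((n : ZMod p) + 1) ^ 3 * u (n + 1)) = 2 * ((2 * n + 1) ^ 3 * u n))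
    {n : ℕ} (hn : n < p) : u n = u 0 * ((-1) ^ n * (m.choose n : ZMod p) ^ 3) := by
  have hm' := two_mul_add_one_eq_zero hm
  have h2 : (2 : ZMod p) ≠ 0 := two_ne_zero_modp hm
  have h16 : (16 : ZMod p) ≠ 0 := by
    rw [show (16 : ZMod p) = 2 ^ 4 by norm_num]; exact pow_ne_zero _ h2
  induction n with
  | zero => simp
  | succ n ih =>
    apply mul_left_cancel₀ (pow_ne_zero 3 (natCast_succ_ne_zero hn))
    apply mul_left_cancel₀ h16
    rw [hu, ih (by omega)]
    have h3 := cast_choose_succ_mul (R := ZMod p) m n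
    have h4 : (2 : ZMod p) * (m.choose (n + 1) * (n + 1)) = m.choose n * (-(2 * n + 1)) := by
      rw [h3]; linear_combination (m.choose n : ZMod p) * hm'
    have h5 := congrArg (· ^ 3) h4
    rw [pow_succ]
    linear_combination (2 * u 0 * (-1) ^ n) * h5

section
variable {p m r : ℕ} [Fact p.Prime]

theorem chooseSqPoly_sq_eval_neg_one (N : ℕ) (hN : 2 * r < N) :
    (chooseSqPoly (ZMod p) r).eval (-1) ^ 2 =
      ∑ n ∈ range N, (chooseSqPoly (ZMod p) r ^ 2).coeff n * (-1) ^ n := by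
  rw [← Polynomial.eval_pow]
  apply Polynomial.eval_eq_sum_range'
  refine lt_of_le_of_lt (Polynomial.natDegree_pow_le.trans ?_) hN
  exact Nat.mul_le_mul_left 2 (natDegree_chooseSqPoly_le r)

theorem sum_chooseSqPoly_sq_coeff (hm : p = 2 * m + 1) (hr : (4 * r + 1 : ZMod p) = 0) :
    ∑ n ∈ range p, (chooseSqPoly (ZMod p) r ^ 2).coeff n * (-1) ^ n =
      ∑ j ∈ range (m + 1), (m.choose j : ZMod p) ^ 3 := by
  rw [sum_subset (range_mono (show m + 1 ≤ p by omega)) (fun k _ hk => by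
      rw [mem_range, not_lt] at hk
      simp [Nat.choose_eq_zero_of_lt (show m < k by omega)])]
  refine sum_congr rfl fun n hn => ?_
  rw [eq_neg_one_pow_mul_choose_cube hm (chooseSqPoly_sq_coeff_succ hr) (mem_range.1 hn)]
  have h1 : ((-1 : ZMod p) ^ n) ^ 2 = 1 := by rw [← pow_mul, mul_comm, pow_mul]; simp
  have h0 : (chooseSqPoly (ZMod p) r ^ 2).coeff 0 = 1 := by simp [chooseSqPoly_sq_coeff]
  rw [h0]
  linear_combination (m.choose n : ZMod p) ^ 3 * h1

theorem sum_choose_cube_eq_eval_sq (hm : p = 2 * m + 1) (hr : p = 4 * r + 1) :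
    ∑ j ∈ range (m + 1), (m.choose j : ZMod p) ^ 3 =
      (chooseSqPoly (ZMod p) r).eval (-1) ^ 2 := by
  have h := congrArg (Nat.cast (R := ZMod p)) hr
  push_cast at h
  rw [ZMod.natCast_self] at h
  rw [chooseSqPoly_sq_eval_neg_one p (by omega), sum_chooseSqPoly_sq_coeff hm h.symm]

theorem two_mul_sum_choose_cube_eq_eval_sq (hm : p = 2 * m + 1) (hr : 3 * p = 4 * r + 1) :
    2 * ∑ j ∈ range (m + 1), (m.choose j : ZMod p) ^ 3 =
      (chooseSqPoly (ZMod p) r).eval (-1) ^ 2 := by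
  have h := congrArg (Nat.cast (R := ZMod p)) hr
  push_cast at h
  rw [ZMod.natCast_self, mul_zero] at h
  have hmo : Odd m := by rw [Nat.odd_iff]; omega
  have hpo : Odd p := by rw [Nat.odd_iff]; omega
  set u : ℕ → ZMod p := fun n => (chooseSqPoly (ZMod p) r ^ 2).coeff (p + n) with hu
  have hrec : ∀ n : ℕ, 16 * (((n : ZMod p) + 1) ^ 3 * u (n + 1)) = 2 * ((2 * n + 1) ^ 3 * u n) := by
    intro n
    have := chooseSqPoly_sq_coeff_succ h.symm (p + n)
    push_cast at this
    rw [ZMod.natCast_self, zero_add] at this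
    exact this
  have hu0 : u 0 = -1 := by
    have h1 := eq_neg_one_pow_mul_choose_cube hm hrec (show m < p by omega)
    have h2 : u m = 1 := by
      simp only [hu]
      rw [show p + m = 2 * r by omega, chooseSqPoly_sq_coeff_two_mul]
    rw [h2, hmo.neg_one_pow, Nat.choose_self] at h1
    push_cast at h1
    linear_combination h1
  rw [chooseSqPoly_sq_eval_neg_one (p + p) (by omega), sum_range_add _ p p,
    ← sum_chooseSqPoly_sq_coeff hm h.symm, two_mul]
  congr 1
  refine sum_congr rfl fun n hn => ?_
  have h1 := eq_neg_one_pow_mul_choose_cube hm hrec (mem_range.1 hn)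
  have h2 := eq_neg_one_pow_mul_choose_cube hm (chooseSqPoly_sq_coeff_succ h.symm)
    (mem_range.1 hn)
  have h0 : (chooseSqPoly (ZMod p) r ^ 2).coeff 0 = 1 := by simp [chooseSqPoly_sq_coeff]
  change _ = u n * _
  rw [h1, h2, h0, hu0, pow_add, hpo.neg_one_pow]
  ring

theorem two_pow_half_sq (hm : p = 2 * m + 1) : (2 : ZMod p) ^ m = 1 ∨ (2 : ZMod p) ^ m = -1 := by
  have := ZMod.pow_div_two_eq_neg_one_or_one p (two_ne_zero_modp hm)
  rwa [show p / 2 = m by omega] at this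

theorem two_pow_half_eq_one_iff (hm : p = 2 * m + 1) :
    (2 : ZMod p) ^ m = 1 ↔ p % 8 = 1 ∨ p % 8 = 7 := by
  rw [← ZMod.exists_sq_eq_two_iff (p := p) (by omega),
    ZMod.euler_criterion p (two_ne_zero_modp hm), show p / 2 = m by omega]

theorem sum_aperyNum_modp_eq_zero (h : p % 8 = 5 ∨ p % 8 = 7) :
    ((∑ n ∈ range p, aperyNum n : ℤ) : ZMod p) = 0 := by
  have hm : p = 2 * (p / 2) + 1 := by omega
  rw [sum_aperyNum_modp hm]
  have h2 := two_ne_zero_modp hm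
  have key : ∀ r, Odd r → (chooseSqPoly (ZMod p) r).eval (-1) ^ 2 = 0 := by
    intro r hr
    have := eval_chooseSqPoly_neg_one_of_odd (R := ZMod p) hr
    simp [(mul_eq_zero.1 this).resolve_left h2]
  rcases h with h | h
  · rw [sum_choose_cube_eq_eval_sq hm (r := p / 4) (by omega),
      key _ (by rw [Nat.odd_iff]; omega), mul_zero]
  · have h3 := two_mul_sum_choose_cube_eq_eval_sq hm (r := (3 * p - 1) / 4) (by omega)
    rw [key _ (by rw [Nat.odd_iff]; omega)] at h3
    rw [(mul_eq_zero.1 h3).resolve_left h2, mul_zero]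

theorem sum_aperyNum_modp_eq_choose_sq {k : ℕ} (hm : p = 2 * m + 1)
    (hk : m = 4 * k ∨ m = 4 * k + 1) :
    ((∑ n ∈ range p, aperyNum n : ℤ) : ZMod p) = (m.choose k : ZMod p) ^ 2 := by
  rw [sum_aperyNum_modp hm]
  have h2 := two_ne_zero_modp hm
  have hs : ∀ n, ((-1 : ZMod p) ^ n) ^ 2 = 1 := fun n => by
    rw [← pow_mul, mul_comm, pow_mul]; simp
  have h4 : ∀ n, ((-4 : ZMod p) ^ n) ^ 2 = 2 ^ (4 * n) := fun n => by
    rw [← pow_mul, mul_comm, pow_mul, pow_mul]; norm_num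
  rcases hk with hk | hk
  · have e2 : (2 : ZMod p) ^ m = 1 := (two_pow_half_eq_one_iff hm).2 (by omega)
    rw [sum_choose_cube_eq_eval_sq hm (r := 2 * k) (by omega), eval_chooseSqPoly_neg_one_two_mul,
      choose_two_mul_self_eq hm (by omega), mul_pow, mul_pow, hs, h4, ← hk, e2,
      (show Even m by rw [Nat.even_iff]; omega).neg_one_pow]
    ring
  · have e2 : (2 : ZMod p) ^ m = -1 := (two_pow_half_sq hm).resolve_left fun h => by
      have := (two_pow_half_eq_one_iff hm).1 h
      omega
    have h3 := two_mul_sum_choose_cube_eq_eval_sq hm (r := 2 * (3 * k + 1)) (by omega)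
    rw [eval_chooseSqPoly_neg_one_two_mul,
      choose_two_mul_self_eq hm (by omega), mul_pow, mul_pow, hs, h4,
      show 4 * (3 * k + 1) = m * 3 + 1 by omega, pow_succ, pow_mul, e2,
      ← Nat.choose_symm (show 3 * k + 1 ≤ m by omega), show m - (3 * k + 1) = k by omega] at h3
    rw [(show Odd m by rw [Nat.odd_iff]; omega).neg_one_pow]
    apply mul_left_cancel₀ h2
    linear_combination -h3

end

theorem pow_add_pow_three_mul_eq (e : ℕ) : ∃ a b : ℤ, ∀ (R : Type) [CommRing R] (w : R),
    w ^ 4 = -1 → w ^ e + w ^ (3 * e) = 2 * a + b * (w + w ^ 3) := by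
  have red : ∀ (R : Type) [CommRing R] (w : R), w ^ 4 = -1 → ∀ i, w ^ i = w ^ (i % 8) := by
    intro R _ w hw i
    have h8 : w ^ 8 = 1 := by rw [show 8 = 4 * 2 by norm_num, pow_mul, hw]; norm_num
    conv_lhs => rw [← Nat.div_add_mod i 8, pow_add, pow_mul, h8, one_pow, one_mul]
  have hlt : e % 8 < 8 := Nat.mod_lt _ (by norm_num)
  suffices h : ∃ a b : ℤ, ∀ (R : Type) [CommRing R] (w : R),
      w ^ 4 = -1 → w ^ (e % 8) + w ^ (3 * (e % 8)) = 2 * a + b * (w + w ^ 3) by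
    obtain ⟨a, b, h⟩ := h
    refine ⟨a, b, fun R _ w hw => ?_⟩
    rw [← h R w hw, red R w hw e, red R w hw (3 * e), red R w hw (3 * (e % 8)), Nat.mul_mod_mod]
  generalize e % 8 = r at hlt
  interval_cases r
  · exact ⟨1, 0, fun R _ w hw => by norm_num⟩
  · exact ⟨0, 1, fun R _ w hw => by push_cast; ring⟩
  · exact ⟨0, 0, fun R _ w hw => by push_cast; linear_combination w ^ 2 * hw⟩
  · exact ⟨0, 1, fun R _ w hw => by push_cast; linear_combination (w ^ 5 - w) * hw⟩
  · exact ⟨-1, 0, fun R _ w hw => by push_cast; linear_combination (w ^ 8 - w ^ 4 + 2) * hw⟩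
  · exact ⟨0, -1, fun R _ w hw => by
      push_cast; linear_combination (w + w ^ 11 - w ^ 7 + w ^ 3) * hw⟩
  · exact ⟨0, 0, fun R _ w hw => by
      push_cast; linear_combination (w ^ 2 + w ^ 14 - w ^ 10 + w ^ 6 - w ^ 2) * hw⟩
  · exact ⟨0, -1, fun R _ w hw => by
      push_cast; linear_combination (w ^ 3 + w ^ 17 - w ^ 13 + w ^ 9 - w ^ 5 + w) * hw⟩

section
variable {F : Type} [Field F] [Fintype F] [DecidableEq F]

theorem two_mul_sum_pow_mul_pow (c : F → ℕ) : ∃ A B : ℤ, ∀ (R : Type) [CommRing R] (w : R),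
    w ^ 4 = -1 → 2 * ∑ x ∈ univ \ {0, 1}, w ^ c x * w ^ (3 * c (1 - x)) =
      2 * A + B * (w + w ^ 3) := by
  choose a b hab using pow_add_pow_three_mul_eq
  refine ⟨∑ x ∈ univ \ {0, 1}, a (c x + 3 * c (1 - x)),
    ∑ x ∈ univ \ {0, 1}, b (c x + 3 * c (1 - x)), fun R _ w hw => ?_⟩
  have h8 : w ^ 8 = 1 := by rw [show 8 = 4 * 2 by norm_num, pow_mul, hw]; norm_num
  have hsymm : ∑ x ∈ univ \ {0, 1}, w ^ c x * w ^ (3 * c (1 - x)) =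
      ∑ x ∈ univ \ {0, 1}, w ^ (3 * (c x + 3 * c (1 - x))) := by
    refine sum_equiv (Equiv.subLeft 1) (fun x => ?_) fun x _ => ?_
    · simp only [mem_sdiff, mem_univ, true_and, mem_insert, mem_singleton, Equiv.subLeft_apply,
        sub_eq_zero, sub_eq_self, eq_comm (a := (1 : F))]
      tauto
    · rw [Equiv.subLeft_apply, sub_sub_cancel, mul_add, pow_add, ← mul_assoc,
        show 3 * 3 = 8 + 1 by norm_num, add_mul, pow_add, pow_mul w 8, h8, one_pow, one_mul,
        one_mul, mul_comm]
  rw [two_mul]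
  nth_rw 2 [hsymm]
  rw [← sum_add_distrib]
  push_cast
  rw [mul_sum, sum_mul, ← sum_add_distrib]
  refine sum_congr rfl fun x _ => ?_
  rw [← pow_add, hab _ R w hw]

omit [DecidableEq F] in
theorem sum_pow_mul_one_sub_pow (a b : ℕ) : ∑ x : F, x ^ a * (1 - x) ^ b =
    ∑ j ∈ range (b + 1), (-1) ^ j * (b.choose j : F) * ∑ x : F, x ^ (a + j) := by
  simp_rw [mul_sum]
  rw [sum_comm]
  refine sum_congr rfl fun x _ => ?_
  rw [sub_eq_neg_add, add_pow, mul_sum]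
  refine sum_congr rfl fun j _ => ?_
  rw [neg_pow, one_pow, pow_add]
  ring

theorem sum_univ_pow {i : ℕ} (hi : i ≠ 0) :
    ∑ x : F, x ^ i = if Fintype.card F - 1 ∣ i then -1 else 0 := by
  rw [← FiniteField.sum_pow_units F i, ← sum_sdiff (subset_univ {(0 : F)}), sum_singleton,
    zero_pow hi, add_zero]
  symm
  refine sum_bij (fun x _ => (x : F)) (by simp) (fun x _ y _ h => Units.ext h)
    (fun x hx => ⟨Units.mk0 x (by simpa using hx), mem_univ _, rfl⟩) (fun _ _ => rfl)

omit [DecidableEq F] in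
theorem sum_pow_mul_one_sub_pow_eq_zero {n : ℕ} (hn : 0 < n) (hq : Fintype.card F = 8 * n + 1) :
    ∑ x : F, x ^ n * (1 - x) ^ (3 * n) = 0 := by
  rw [sum_pow_mul_one_sub_pow]
  refine sum_eq_zero fun j hj => ?_
  rw [mem_range] at hj
  rw [FiniteField.sum_pow_lt_card_sub_one _ _ (by omega), mul_zero]

theorem sum_pow_mul_one_sub_pow_eq_choose {n : ℕ} (hn : 0 < n)
    (hq : Fintype.card F = 8 * n + 1) :
    ∑ x : F, x ^ (7 * n) * (1 - x) ^ (5 * n) = -((-1) ^ n * ((5 * n).choose n : F)) := by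
  rw [sum_pow_mul_one_sub_pow, sum_eq_single n]
  · rw [sum_univ_pow (by omega), hq, if_pos ⟨1, by omega⟩]; ring
  · intro j hj hjn
    rw [mem_range] at hj
    rw [sum_univ_pow (by omega), hq, if_neg, mul_zero]
    rintro ⟨t, ht⟩
    rw [Nat.add_sub_cancel] at ht
    have h1 : t < 2 := by
      by_contra! h
      have := Nat.mul_le_mul_left (8 * n) h
      omega
    interval_cases t <;> omega
  · intro h
    exact absurd (mem_range.2 (by omega)) h

theorem pow_four_eq_neg_one {R : Type*} [CommRing R] [IsDomain R] {w : R} (h8 : w ^ 8 = 1)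
    (h4 : w ^ 4 ≠ 1) : w ^ 4 = -1 := by
  have : (w ^ 4 - 1) * (w ^ 4 + 1) = 0 := by linear_combination h8
  rcases mul_eq_zero.1 this with h | h
  · exact absurd (sub_eq_zero.1 h) h4
  · exact eq_neg_of_add_eq_zero_left h

/-- The Jacobi sum of an octic character `χ` with `χ ^ 3` lies in `ℤ[√-2]` and has norm `#F`. Its
conjugate is computed in `F` by evaluating the characters as power maps. -/
theorem exists_sq_add_two_mul_sq_eq_card {n : ℕ} (hn : 0 < n)
    (hq : Fintype.card F = 8 * n + 1) : ∃ A B : ℤ, A ^ 2 + 2 * B ^ 2 = Fintype.card F ∧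
      (2 * A : F) = -((-1) ^ n * ((5 * n).choose n : F)) := by
  obtain ⟨χ, hχ⟩ := MulChar.exists_mulChar_orderOf F (R := ℂ) (n := 8) ⟨n, by omega⟩
    (Complex.isPrimitiveRoot_exp 8 (by norm_num))
  obtain ⟨g, hg⟩ := IsCyclic.exists_generator (α := Fˣ)
  have hog : orderOf g = 8 * n := by
    rw [orderOf_eq_card_of_forall_mem_zpowers hg, Nat.card_eq_fintype_card, Fintype.card_units, hq]
    omega
  set w : ℂ := χ g with hw
  set z : F := (g : F) ^ n with hz
  have hχ8 : χ ^ 8 = 1 := by rw [← hχ, pow_orderOf_eq_one]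
  have hχ' : ∀ i, 0 < i → i < 8 → χ ^ i ≠ 1 := fun i h0 h =>
    pow_ne_one_of_lt_orderOf h0.ne' (by omega)
  have hw4 : w ^ 4 = -1 := by
    apply pow_four_eq_neg_one
    · rw [hw, ← MulChar.pow_apply_coe, hχ8, MulChar.one_apply_coe]
    · intro h
      apply hχ' 4 (by norm_num) (by norm_num)
      rw [MulChar.eq_iff hg, MulChar.pow_apply_coe, MulChar.one_apply_coe]
      exact h
  have hz4 : z ^ 4 = -1 := by
    apply pow_four_eq_neg_one
    · rw [hz, ← pow_mul, mul_comm, ← hog]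
      rw [← Units.val_pow_eq_pow_val, pow_orderOf_eq_one, Units.val_one]
    · intro h
      rw [hz, ← pow_mul] at h
      exact pow_ne_one_of_lt_orderOf (x := g) (n := n * 4) (by omega) (by omega)
        (Units.ext (by rw [Units.val_pow_eq_pow_val, h, Units.val_one]))
  have hex : ∀ x : F, ∃ c : ℕ, x ≠ 0 → χ x = w ^ c ∧ x ^ n = z ^ c := by
    intro x
    by_cases hx : x = 0
    · exact ⟨0, fun h => absurd hx h⟩
    obtain ⟨c, hc⟩ := (Submonoid.mem_powers_iff _ _).1
      ((mem_powers_iff_mem_zpowers (x := g)).2 (hg (Units.mk0 x hx)))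
    have hc' : x = (g : F) ^ c := by
      have := congrArg Units.val hc
      simpa using this.symm
    refine ⟨c, fun _ => ⟨?_, ?_⟩⟩
    · rw [hc', map_pow]
    · rw [hc', hz, ← pow_mul, ← pow_mul, mul_comm]
  clear_value w z
  choose c hc using hex
  obtain ⟨A, B, hAB⟩ := two_mul_sum_pow_mul_pow c
  have mem : ∀ x : F, x ∈ univ \ ({0, 1} : Finset F) → x ≠ 0 ∧ 1 - x ≠ 0 := by
    intro x hx
    simp only [mem_sdiff, mem_univ, true_and, mem_insert, mem_singleton, not_or] at hx
    exact ⟨hx.1, sub_ne_zero.2 (Ne.symm hx.2)⟩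
  have conj4 : ∀ (R : Type) [CommRing R] (v : R), v ^ 4 = -1 → (v ^ 7) ^ 4 = -1 := by
    intro R _ v hv
    rw [← pow_mul, mul_comm, pow_mul, hv]; norm_num
  have conj : ∀ (R : Type) [CommRing R] (v : R), v ^ 4 = -1 →
      v ^ 7 + (v ^ 7) ^ 3 = -(v + v ^ 3) := by
    intro R _ v hv
    linear_combination (v ^ 3 + v ^ 17 - v ^ 13 + v ^ 9 - v ^ 5 + v) * hv
  have J1 : jacobiSum χ (χ ^ 3) = ∑ x ∈ univ \ {0, 1}, w ^ c x * w ^ (3 * c (1 - x)) := by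
    rw [jacobiSum_eq_sum_sdiff]
    refine sum_congr rfl fun x hx => ?_
    obtain ⟨h0, h1⟩ := mem x hx
    rw [MulChar.pow_apply' _ (by norm_num), (hc x h0).1, (hc _ h1).1, ← pow_mul, mul_comm 3]
  have w7 : ∀ i, (w ^ 7) ^ i = (w ^ i)⁻¹ := by
    intro i
    rw [← inv_pow]
    congr 1
    apply eq_inv_of_mul_eq_one_left
    rw [← pow_succ, show 7 + 1 = 4 * 2 by norm_num, pow_mul, hw4]; norm_num
  have J2 : jacobiSum χ⁻¹ (χ ^ 3)⁻¹ =
      ∑ x ∈ univ \ {0, 1}, (w ^ 7) ^ c x * (w ^ 7) ^ (3 * c (1 - x)) := by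
    rw [jacobiSum_eq_sum_sdiff]
    refine sum_congr rfl fun x hx => ?_
    obtain ⟨h0, h1⟩ := mem x hx
    rw [MulChar.inv_apply_eq_inv', MulChar.inv_apply_eq_inv', MulChar.pow_apply' _ (by norm_num),
      (hc x h0).1, (hc _ h1).1, ← pow_mul, mul_comm _ 3, w7, w7]
  have hJ := jacobiSum_mul_jacobiSum_inv (F := F) (F' := ℂ) (χ := χ) (φ := χ ^ 3) (by
      rw [ringChar.eq ℂ 0]
      exact (CharP.ringChar_ne_zero_of_finite F).symm)
    (by simpa using hχ' 1 (by norm_num) (by norm_num)) (hχ' 3 (by norm_num) (by norm_num))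
    (by rw [← pow_succ']; exact hχ' 4 (by norm_num) (by norm_num))
  have e1 := hAB ℂ w hw4
  have e2 := hAB ℂ (w ^ 7) (conj4 ℂ w hw4)
  rw [conj ℂ w hw4, ← J2] at e2
  rw [← J1] at e1
  have hnorm : 2 * A ^ 2 + B ^ 2 = 2 * (Fintype.card F : ℤ) := by
    have hs : (w + w ^ 3) ^ 2 = -2 := by linear_combination (w ^ 2 + 2) * hw4
    have : (2 : ℂ) * A ^ 2 + B ^ 2 = 2 * (Fintype.card F : ℂ) := by
      have h := congrArg₂ (· * ·) e1 e2
      linear_combination -h / 2 + 2 * hJ + (B : ℂ) ^ 2 / 2 * hs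
    exact_mod_cast this
  have hBe : Even B := by
    rw [← Int.even_pow' (n := 2) (by norm_num)]
    exact ⟨Fintype.card F - A ^ 2, by linarith⟩
  obtain ⟨B', hB'⟩ := hBe
  refine ⟨A, B', by subst hB'; linarith, ?_⟩
  have f1 := hAB F z hz4
  have f2 := hAB F (z ^ 7) (conj4 F z hz4)
  rw [conj F z hz4] at f2
  have extend : ∀ a b : ℕ, a ≠ 0 → b ≠ 0 → ∑ x ∈ univ \ {0, 1}, x ^ a * (1 - x) ^ b =
      ∑ x : F, x ^ a * (1 - x) ^ b := by
    intro a b ha hb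
    refine sum_subset (subset_univ _) fun x _ hx => ?_
    simp only [mem_sdiff, mem_univ, true_and, mem_insert, mem_singleton, not_not] at hx
    rcases hx with rfl | rfl <;> simp [ha, hb]
  have K1 : ∑ x ∈ univ \ {0, 1}, z ^ c x * z ^ (3 * c (1 - x)) = 0 := by
    refine Eq.trans ?_ (sum_pow_mul_one_sub_pow_eq_zero hn hq)
    rw [← extend _ _ (by omega) (by omega)]
    refine sum_congr rfl fun x hx => ?_
    obtain ⟨h0, h1⟩ := mem x hx
    rw [(hc x h0).2, mul_comm 3 n, pow_mul (1 - x), (hc _ h1).2, mul_comm 3, pow_mul]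
  have K2 : ∑ x ∈ univ \ {0, 1}, (z ^ 7) ^ c x * (z ^ 7) ^ (3 * c (1 - x)) =
      -((-1) ^ n * ((5 * n).choose n : F)) := by
    rw [← sum_pow_mul_one_sub_pow_eq_choose hn hq, ← extend _ _ (by omega) (by omega)]
    refine sum_congr rfl fun x hx => ?_
    obtain ⟨h0, h1⟩ := mem x hx
    have z8 : z ^ 8 = 1 := by rw [show 8 = 4 * 2 by norm_num, pow_mul, hz4]; norm_num
    have z16 : ∀ i, z ^ (16 * i) = 1 := fun i => by
      rw [show 16 * i = 8 * (2 * i) by ring, pow_mul, z8, one_pow]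
    rw [mul_comm 7 n, pow_mul x, mul_comm 5 n, pow_mul (1 - x), (hc x h0).2, (hc _ h1).2,
      ← pow_mul, ← pow_mul, ← pow_mul, ← pow_mul, mul_comm 7,
      show 7 * (3 * c (1 - x)) = 16 * c (1 - x) + c (1 - x) * 5 by ring, pow_add, z16, one_mul]
  rw [K1] at f1
  rw [K2] at f2
  have h8 : (8 * n + 1 : F) = 0 := by
    have := congrArg (Nat.cast (R := F)) hq
    push_cast at this
    rw [← this, FiniteField.cast_card_eq_zero]
  linear_combination (4 * (n : F)) * f1 + (4 * (n : F)) * f2 +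
    (2 * A + ((-1) ^ n * ((5 * n).choose n : F))) * h8
end

theorem sq_eq_of_dvd_sub {N A B X Y : ℤ} (hN : 0 < N) (h1 : A ^ 2 + 2 * B ^ 2 = N)
    (h2 : X ^ 2 + 2 * Y ^ 2 = N) (h : N ∣ A * Y - B * X) : A ^ 2 = X ^ 2 := by
  obtain ⟨e, he⟩ := h
  have key : (A * X + 2 * B * Y) ^ 2 + 2 * (A * Y - B * X) ^ 2 = N ^ 2 := by
    linear_combination (X ^ 2 + 2 * Y ^ 2) * h1 + N * h2
  have he0 : e = 0 := by
    by_contra h0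
    have h1e : 0 < e ^ 2 := by positivity
    rw [he] at key
    nlinarith [sq_nonneg (A * X + 2 * B * Y), pow_pos hN 2]
  rw [he0, mul_zero, sub_eq_zero] at he
  refine mul_left_cancel₀ hN.ne' ?_
  linear_combination X ^ 2 * h1 - A ^ 2 * h2 + 2 * (A * Y + B * X) * he

theorem sq_eq_of_dvd_sub_or_dvd_add {N A B X Y : ℤ} (hN : 0 < N) (h1 : A ^ 2 + 2 * B ^ 2 = N)
    (h2 : X ^ 2 + 2 * Y ^ 2 = N) (h : N ∣ A * Y - B * X ∨ N ∣ A * Y + B * X) : A ^ 2 = X ^ 2 := by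
  rcases h with h | h
  · exact sq_eq_of_dvd_sub hN h1 h2 h
  · exact sq_eq_of_dvd_sub (B := -B) hN (by linear_combination h1) h2
      (by rwa [neg_mul, sub_neg_eq_add])

theorem dvd_sub_mul_add {N A B X Y : ℤ} (h1 : A ^ 2 + 2 * B ^ 2 = N)
    (h2 : X ^ 2 + 2 * Y ^ 2 = N) : N ∣ (A * Y - B * X) * (A * Y + B * X) :=
  ⟨Y ^ 2 - B ^ 2, by linear_combination Y ^ 2 * h1 - B ^ 2 * h2⟩

section
variable {p k : ℕ} [Fact p.Prime]

theorem not_dvd_of_eq_sq_add_two_mul_sq (h2 : (2 : ZMod p) ≠ 0) {x y : ℤ}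
    (hxy : (p : ℤ) = x ^ 2 + 2 * y ^ 2) : ¬ (p : ℤ) ∣ x ∧ ¬ (p : ℤ) ∣ y := by
  have hpi : Prime (p : ℤ) := Nat.prime_iff_prime_int.1 Fact.out
  have hsum : (x : ZMod p) ^ 2 + 2 * (y : ZMod p) ^ 2 = 0 := by
    have := congrArg (Int.cast (R := ZMod p)) hxy
    push_cast at this
    rw [← this, ZMod.natCast_self]
  have hiff : (p : ℤ) ∣ x ↔ (p : ℤ) ∣ y := by
    simp only [← ZMod.intCast_zmod_eq_zero_iff_dvd]
    constructor <;> intro h <;> simpa [h, h2] using hsum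
  have hnot : ¬ ((p : ℤ) ∣ x ∧ (p : ℤ) ∣ y) := by
    rintro ⟨⟨a, rfl⟩, ⟨b, rfl⟩⟩
    refine hpi.not_isUnit (IsUnit.of_mul_eq_one (a ^ 2 + 2 * b ^ 2)
      (mul_left_cancel₀ hpi.ne_zero ?_))
    linear_combination -hxy
  tauto

theorem choose_sq_eq_of_eq_eight_mul_add_one (hp : p = 8 * k + 1) {x y : ℤ}
    (hxy : (p : ℤ) = x ^ 2 + 2 * y ^ 2) : ((4 * k).choose k : ZMod p) ^ 2 = 4 * x ^ 2 := by
  have hpp : p.Prime := Fact.out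
  have hk : 0 < k := by
    have := hpp.two_le
    omega
  obtain ⟨A, B, hAB, hA⟩ := exists_sq_add_two_mul_sq_eq_card (F := ZMod p) hk
    (by rw [ZMod.card, hp])
  rw [ZMod.card] at hAB
  have hsq : A ^ 2 = x ^ 2 :=
    sq_eq_of_dvd_sub_or_dvd_add (by exact_mod_cast hpp.pos) hAB hxy.symm
      ((Nat.prime_iff_prime_int.1 hpp).dvd_or_dvd (dvd_sub_mul_add hAB hxy.symm))
  rw [choose_eq_neg_one_pow_mul_choose (a := 5 * k) (b := 4 * k) (by omega)
    (by rw [show 5 * k + 4 * k + 1 = p + k by omega]; simp), ← mul_assoc, ← mul_pow,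
    neg_one_mul, neg_neg, one_pow, one_mul] at hA
  have hsq' := congrArg (Int.cast (R := ZMod p)) hsq
  push_cast at hsq'
  rw [← hsq', ← neg_sq, ← hA]
  ring

theorem choose_five_mul_eq_neg_choose_sq (hp : p = 8 * k + 3) :
    ((5 * (k * p + (3 * k + 1))).choose (k * p + (3 * k + 1)) : ZMod p) =
      -((4 * k + 1).choose k : ZMod p) ^ 2 := by
  have hp0 : 0 < p := by omega
  have hlucas := (ZMod.natCast_eq_natCast_iff _ _ p).2
    (Choose.choose_modEq_choose_mod_mul_choose_div_nat
      (n := (7 * k + 2) + p * (5 * k + 1)) (k := (3 * k + 1) + p * k) (p := p))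
  rw [Nat.add_mul_mod_self_left, Nat.add_mul_mod_self_left, Nat.add_mul_div_left _ _ hp0,
    Nat.add_mul_div_left _ _ hp0, Nat.mod_eq_of_lt (a := 7 * k + 2) (by omega),
    Nat.mod_eq_of_lt (a := 3 * k + 1) (by omega), Nat.div_eq_of_lt (a := 7 * k + 2) (by omega),
    Nat.div_eq_of_lt (a := 3 * k + 1) (by omega), zero_add, zero_add, Nat.cast_mul,
    choose_eq_neg_one_pow_mul_choose (a := 7 * k + 2) (b := 4 * k + 1) (by omega)
      (by rw [show 7 * k + 2 + (4 * k + 1) + 1 = p + (3 * k + 1) by omega]; simp),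
    choose_eq_neg_one_pow_mul_choose (a := 5 * k + 1) (b := 4 * k + 1) (by omega)
      (by rw [show 5 * k + 1 + (4 * k + 1) + 1 = p + k by omega]; simp),
    Nat.choose_symm_of_eq_add (n := 4 * k + 1) (a := 3 * k + 1) (b := k) (by omega)] at hlucas
  have hsign : (-1 : ZMod p) ^ (3 * k + 1) * (-1) ^ k = -1 := by
    rw [← pow_add, Odd.neg_one_pow ⟨2 * k, by ring⟩]
  rw [show 5 * (k * p + (3 * k + 1)) = (7 * k + 2) + p * (5 * k + 1) by rw [hp]; ring,
    mul_comm k p, add_comm (p * k), hlucas]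
  linear_combination ((4 * k + 1).choose k : ZMod p) ^ 2 * hsign

theorem choose_sq_eq_of_eq_eight_mul_add_three (hp : p = 8 * k + 3) {x y : ℤ}
    (hxy : (p : ℤ) = x ^ 2 + 2 * y ^ 2) : ((4 * k + 1).choose k : ZMod p) ^ 2 = 4 * x ^ 2 := by
  classical
  have hpp : p.Prime := Fact.out
  have hpi := Nat.prime_iff_prime_int.1 hpp
  have h2 : (2 : ZMod p) ≠ 0 := two_ne_zero_modp (m := 4 * k + 1) (by omega)
  let := Fintype.ofFinite (GaloisField p 2)
  have hcard : Fintype.card (GaloisField p 2) = p ^ 2 := by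
    rw [← Nat.card_eq_fintype_card, GaloisField.card p 2 two_ne_zero]
  obtain ⟨A, B, hAB, hA⟩ := exists_sq_add_two_mul_sq_eq_card (F := GaloisField p 2)
    (n := k * p + (3 * k + 1)) (by omega) (by rw [hcard, hp]; ring)
  rw [hcard] at hAB
  push_cast at hAB
  rw [Odd.neg_one_pow ⟨4 * k ^ 2 + 3 * k, by rw [hp]; ring⟩, neg_one_mul, neg_neg] at hA
  have hA' : (2 * A : ZMod p) = -((4 * k + 1).choose k : ZMod p) ^ 2 := by
    rw [← choose_five_mul_eq_neg_choose_sq hp]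
    apply (algebraMap (ZMod p) (GaloisField p 2)).injective
    rw [map_mul, map_ofNat, map_intCast, map_natCast, hA]
  have hC : ((4 * k + 1).choose k : ZMod p) ≠ 0 := by
    rw [Ne, ZMod.natCast_eq_zero_iff]
    intro h
    have hd : p ∣ (4 * k + 1).factorial := by
      rw [← Nat.choose_mul_factorial_mul_factorial (n := 4 * k + 1) (k := k) (by omega)]
      exact dvd_mul_of_dvd_left (dvd_mul_of_dvd_left h _) _
    have := hpp.dvd_factorial.1 hd
    omega
  have hpA : ¬ (p : ℤ) ∣ A := by
    rw [← ZMod.intCast_zmod_eq_zero_iff_dvd]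
    intro h
    rw [h, mul_zero, eq_comm, neg_eq_zero] at hA'
    exact hC (pow_eq_zero_iff two_ne_zero |>.1 hA')
  have hpxy := not_dvd_of_eq_sq_add_two_mul_sq h2 hxy
  have hp2 : ¬ (p : ℤ) ∣ 2 := by
    rw [← ZMod.intCast_zmod_eq_zero_iff_dvd]
    exact_mod_cast h2
  have hXY : (x ^ 2 - 2 * y ^ 2) ^ 2 + 2 * (2 * x * y) ^ 2 = (p : ℤ) ^ 2 := by
    rw [hxy]; ring
  have hsq : A ^ 2 = (x ^ 2 - 2 * y ^ 2) ^ 2 := by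
    refine sq_eq_of_dvd_sub_or_dvd_add (by have := hpp.pos; positivity) hAB hXY ?_
    have hdvd := dvd_sub_mul_add hAB hXY
    by_cases h : (p : ℤ) ∣ A * (2 * x * y) - B * (x ^ 2 - 2 * y ^ 2)
    · refine Or.inl (hpi.pow_dvd_of_dvd_mul_right 2 (fun h' => ?_) hdvd)
      have h4 : (p : ℤ) ∣ 2 * (A * (2 * x * y)) := by
        have hadd := dvd_add h h'
        rwa [sub_add_add_cancel, ← two_mul] at hadd
      simp only [hpi.dvd_mul, hp2, hpA, hpxy.1, hpxy.2, or_self] at h4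
    · exact Or.inr (hpi.pow_dvd_of_dvd_mul_left 2 h hdvd)
  have hX : ((x ^ 2 - 2 * y ^ 2 : ℤ) : ZMod p) = 2 * x ^ 2 := by
    have := congrArg (Int.cast (R := ZMod p)) hxy
    push_cast at this ⊢
    rw [ZMod.natCast_self] at this
    linear_combination this
  rcases sq_eq_sq_iff_eq_or_eq_neg.1 hsq with h | h
  · rw [h, hX] at hA'
    refine absurd (by omega) (ZMod.mod_four_ne_three_of_sq_eq_neg_sq' (p := p)
      (x := ((4 * k + 1).choose k : ZMod p)) (y := 2 * x) (mul_ne_zero h2 ?_)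
      (by linear_combination hA'))
    rw [Ne, ZMod.intCast_zmod_eq_zero_iff_dvd]
    exact hpxy.1
  · rw [h, Int.cast_neg, hX] at hA'
    linear_combination hA'
end

end

/-- For an odd prime `p`, `∑_{k=0}^{p-1} A_k ≡ c(p) (mod p)`, where `c(p) = 4x² - 2p`
if `p ≡ 1, 3 (mod 8)` and `p = x² + 2y²`, and `c(p) = 0` if `p ≡ 5, 7 (mod 8)`. -/
theorem sum_apery_num_mod_p (p : ℕ) (hp : p.Prime) (hp2 : p ≠ 2) :
    ((p % 8 = 1 ∨ p % 8 = 3) → ∀ x y : ℤ, (p : ℤ) = x ^ 2 + 2 * y ^ 2 →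
      (∑ k ∈ Finset.range p, aperyNum k) ≡ 4 * x ^ 2 - 2 * p [ZMOD (p : ℤ)]) ∧
    ((p % 8 = 5 ∨ p % 8 = 7) →
      (∑ k ∈ Finset.range p, aperyNum k) ≡ 0 [ZMOD (p : ℤ)]) := by
  have := Fact.mk hp
  refine ⟨fun h x y hxy => ?_, fun h => ?_⟩
  · rw [← ZMod.intCast_eq_intCast_iff]
    push_cast
    rw [ZMod.natCast_self, mul_zero, sub_zero, ← Int.cast_sum]
    rcases h with h | h
    · rw [sum_aperyNum_modp_eq_choose_sq (m := 4 * (p / 8)) (k := p / 8) (by omega) (Or.inl rfl),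
        choose_sq_eq_of_eq_eight_mul_add_one (by omega) hxy]
    · rw [sum_aperyNum_modp_eq_choose_sq (m := 4 * (p / 8) + 1) (k := p / 8) (by omega)
        (Or.inr rfl), choose_sq_eq_of_eq_eight_mul_add_three (by omega) hxy]
  · rw [← ZMod.intCast_eq_intCast_iff, sum_aperyNum_modp_eq_zero h, Int.cast_zero]
end

section
/- Let p be an odd prime. If p ≡ 1 (mod 3) and p = x² + 3y² with x, y integers, then ∑_{k=0}^{p-1} (-1)^k A_k ≡ 4x² - 2p (mod p). If p ≡ 2 (mod 3), then ∑_{k=0}^{p-1} (-1)^k A_k ≡ 0 (mod p²). -/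
section AperyReduction

open Finset

theorem choose_succ_right_mul_int (N K : ℕ) :
    ((N.choose (K + 1) : ℕ) : ℤ) * (K + 1) = N.choose K * ((N : ℤ) - K) := by
  rcases le_or_gt K N with h | h
  · have := N.choose_succ_right_eq K
    rw [← Nat.cast_sub h]
    exact_mod_cast this
  · simp [Nat.choose_eq_zero_of_lt h, Nat.choose_eq_zero_of_lt (h.trans (Nat.lt_succ_self K))]

theorem choose_mul_choose_add (m k : ℕ) :
    m.choose k * (m + k).choose k = (2 * k).choose k * (m + k).choose (2 * k) := by
  have h := Nat.choose_mul (n := m + k) (k := 2 * k) (s := k) (by omega)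
  rw [Nat.add_sub_cancel, show 2 * k - k = k by omega] at h
  rw [mul_comm, ← h, mul_comm]

theorem sum_alternating_choose_sq_recurrence (k N : ℕ) :
    8 * ((k : ℤ) + 1) ^ 2 *
        ∑ m ∈ range N, (-1 : ℤ) ^ m * ((m + (k + 1)).choose (2 * (k + 1)) : ℤ) ^ 2
      - (2 * k + 1) * (k + 1) * ∑ m ∈ range N, (-1 : ℤ) ^ m * ((m + k).choose (2 * k) : ℤ) ^ 2
      = (-1) ^ N * ((N + k).choose (2 * k + 1) : ℤ) ^ 2 * ((3 * k + 2) * (k + 1) - (N : ℤ) ^ 2) := by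
  induction N with
  | zero => simp [Nat.choose_eq_zero_of_lt (show k < 2 * k + 1 by omega)]
  | succ N ih =>
    rw [sum_range_succ, sum_range_succ]
    have h1 := choose_succ_right_mul_int (N + k) (2 * k)
    have h2 : ((2 * k : ℤ) + 1) * ((N + 1 + k).choose (2 * k + 1) : ℤ) =
        (N + k + 1) * ((N + k).choose (2 * k) : ℤ) := by
      have := Nat.add_one_mul_choose_eq (N + k) (2 * k)
      rw [show N + 1 + k = N + k + 1 by ring]
      push_cast [← @Nat.cast_inj ℤ] at this
      linarith
    have h3 := choose_succ_right_mul_int (N + 1 + k) (2 * k + 1)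
    rw [show N + (k + 1) = N + 1 + k by ring, show 2 * (k + 1) = 2 * k + 1 + 1 by ring]
    rw [show 2 * (k + 1) = 2 * k + 1 + 1 by ring] at ih
    generalize ((N + 1 + k).choose (2 * k + 1 + 1) : ℤ) = w at *
    generalize ((N + 1 + k).choose (2 * k + 1) : ℤ) = v at *
    generalize ((N + k).choose (2 * k + 1) : ℤ) = u at *
    generalize ((N + k).choose (2 * k) : ℤ) = t at *
    push_cast at *
    have hk : ((2 * k : ℤ) + 1) ^ 2 ≠ 0 := by positivity
    have h4 : 8 * ((k : ℤ) + 1) ^ 2 * w ^ 2 = 2 * (v * (N - k)) ^ 2 := by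
      linear_combination 2 * (2 * (k + 1 : ℤ) * w + v * (N - k)) * h3
    have key : 8 * ((k : ℤ) + 1) ^ 2 * w ^ 2 - (2 * k + 1) * (k + 1) * t ^ 2 =
        - v ^ 2 * ((3 * k + 2) * (k + 1) - ((N : ℤ) + 1) ^ 2)
          - u ^ 2 * ((3 * k + 2) * (k + 1) - (N : ℤ) ^ 2) := by
      rw [h4]
      apply mul_left_cancel₀ hk
      have e1 : ((2 * k : ℤ) + 1) ^ 2 * u ^ 2 = (t * (N - k)) ^ 2 := by
        linear_combination (u * (2 * k + 1) + t * (N - k)) * h1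
      have e2 : ((2 * k : ℤ) + 1) ^ 2 * v ^ 2 = ((N + k + 1) * t) ^ 2 := by
        linear_combination ((2 * k + 1) * v + (N + k + 1) * t) * h2
      linear_combination (2 * (N - k : ℤ) ^ 2 + ((3 * k + 2) * (k + 1) - ((N : ℤ) + 1) ^ 2)) * e2 +
        ((3 * k + 2) * (k + 1) - (N : ℤ) ^ 2) * e1
    rw [pow_succ]
    linear_combination ih + (-1) ^ N * key

theorem sum_neg_one_pow_mul_aperyNum (N : ℕ) :
    ∑ m ∈ range N, (-1 : ℤ) ^ m * aperyNum m =
      ∑ k ∈ range N, ((2 * k).choose k : ℤ) ^ 2 *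
        ∑ m ∈ range N, (-1 : ℤ) ^ m * ((m + k).choose (2 * k) : ℤ) ^ 2 := by
  simp_rw [mul_sum]
  rw [sum_comm]
  refine sum_congr rfl fun m hm => ?_
  rw [mem_range] at hm
  rw [aperyNum, mul_sum, ← sum_subset (range_subset_range.2 (Nat.succ_le_of_lt hm))]
  · refine sum_congr rfl fun k _ => ?_
    have := congrArg (Nat.cast : ℕ → ℤ) (choose_mul_choose_add m k)
    push_cast at this
    rw [← mul_pow, this]
    ring
  · intro k _ hk
    rw [mem_range, not_lt] at hk
    simp [Nat.choose_eq_zero_of_lt (show m + k < 2 * k by omega)]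

theorem isCoprime_sq_of_pos_of_lt {p : ℕ} (hp : p.Prime) {a : ℕ} (ha : 0 < a) (hap : a < p) :
    IsCoprime (a : ℤ) ((p : ℤ) ^ 2) := by
  rw [IsCoprime.pow_right_iff (by norm_num), Nat.isCoprime_iff_coprime]
  exact (hp.coprime_iff_not_dvd.2 (Nat.not_dvd_of_pos_of_lt ha hap)).symm

theorem sum_alternating_choose_sq_modEq {n p : ℕ} (hp : p.Prime) (hn : p = 2 * n + 1) {k : ℕ}
    (hk : k ≤ n) :
    ∑ m ∈ range p, (-1 : ℤ) ^ m * ((m + k).choose (2 * k) : ℤ) ^ 2 ≡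
      (-1) ^ k * (n + k).choose (2 * k) [ZMOD (p : ℤ) ^ 2] := by
  induction k with
  | zero =>
    have : ∑ m ∈ range p, (-1 : ℤ) ^ m = 1 := by
      rw [hn]
      simp [neg_one_geom_sum]
    simp [this]
  | succ k ih =>
    have ih := ih (by omega)
    have hrec := sum_alternating_choose_sq_recurrence k p
    have hdvd : (p : ℤ) ^ 2 ∣ ((p + k).choose (2 * k + 1) : ℤ) ^ 2 := by
      refine pow_dvd_pow_of_dvd ?_ 2
      exact_mod_cast hp.dvd_choose (by omega) (by omega) (by omega)
    have hc := choose_succ_right_mul_int (n + k + 1) (2 * k + 1)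
    have hc' := Nat.add_one_mul_choose_eq (n + k) (2 * k)
    push_cast [← @Nat.cast_inj ℤ] at hc'
    rw [show n + (k + 1) = n + k + 1 by ring, show 2 * (k + 1) = 2 * k + 1 + 1 by ring] at *
    have hcop : IsCoprime (8 * ((k : ℤ) + 1) ^ 2 * (2 * k + 1)) ((p : ℤ) ^ 2) := by
      have h1 := isCoprime_sq_of_pos_of_lt hp (a := k + 1) (by omega) (by omega)
      have h2 := isCoprime_sq_of_pos_of_lt hp (a := 2 * k + 1) (by omega) (by omega)
      have h3 := isCoprime_sq_of_pos_of_lt hp (a := 2) (by omega) (by omega)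
      push_cast at h1 h2 h3
      rw [show (8 : ℤ) = 2 ^ 3 by norm_num]
      exact (h3.pow_left.mul_left h1.pow_left).mul_left h2
    rw [Int.modEq_iff_dvd] at ih ⊢
    refine hcop.symm.dvd_of_dvd_mul_left ?_
    obtain ⟨a, ha⟩ := ih
    obtain ⟨b, hb⟩ := hdvd
    rw [hb] at hrec
    push_cast at *
    have hp' : (p : ℤ) = 2 * n + 1 := by exact_mod_cast hn
    generalize ((n + k + 1).choose (2 * k + 1 + 1) : ℤ) = w at *
    generalize ((n + k + 1).choose (2 * k + 1) : ℤ) = v at *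
    generalize ((n + k).choose (2 * k) : ℤ) = t at *
    have hw : 8 * ((k : ℤ) + 1) * (2 * k + 1) * w = (p ^ 2 - (2 * k + 1) ^ 2) * t := by
      rw [hp']
      linear_combination 4 * (2 * k + 1 : ℤ) * hc - 4 * ((n : ℤ) - k) * hc'
    rw [pow_succ]
    refine ⟨(2 * k + 1) ^ 2 * (k + 1) * a - (2 * k + 1) * ((-1) ^ p * b * ((3 * k + 2) * (k + 1) - (p : ℤ) ^ 2))
      - (-1) ^ k * (k + 1) * t, ?_⟩
    linear_combination (-1) * (2 * k + 1 : ℤ) * hrec - (-1) ^ k * (k + 1 : ℤ) * hw + (2 * k + 1) ^ 2 * (k + 1 : ℤ) * ha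

theorem sum_neg_one_pow_mul_aperyNum_modEq {n p : ℕ} (hp : p.Prime) (hn : p = 2 * n + 1) :
    ∑ m ∈ range p, (-1 : ℤ) ^ m * aperyNum m ≡
      ∑ k ∈ range (n + 1), ((2 * k).choose k : ℤ) ^ 2 * (n + k).choose (2 * k) * (-1) ^ k
      [ZMOD (p : ℤ) ^ 2] := by
  rw [sum_neg_one_pow_mul_aperyNum, ← sum_range_add_sum_Ico _ (show n + 1 ≤ p by omega),
    ← add_zero (∑ k ∈ range (n + 1), ((2 * k).choose k : ℤ) ^ 2 * (n + k).choose (2 * k) * (-1) ^ k)]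
  refine Int.ModEq.add (Int.ModEq.sum fun k hk => ?_) ?_
  · rw [mul_assoc, mul_comm (((n + k).choose (2 * k) : ℕ) : ℤ)]
    exact (sum_alternating_choose_sq_modEq hp hn (by simpa [Nat.lt_succ_iff] using hk)).mul_left _
  · rw [Int.modEq_zero_iff_dvd]
    refine dvd_sum fun k hk => Dvd.dvd.mul_right (pow_dvd_pow_of_dvd ?_ 2) _
    rw [mem_Ico] at hk
    exact_mod_cast hp.dvd_choose (by omega) (by omega) (by omega)

end AperyReduction

section Clausen

open Finset Polynomial

/-- The polynomial `∑ₖ C(n,k) C(n+k,k) Xᵏ`, that is, the Legendre polynomial `Pₙ(1 + 2X)`. -/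
noncomputable def legendreShift (n : ℕ) : ℤ[X] :=
  ∑ k ∈ range (n + 1), C ((n.choose k : ℤ) * (n + k).choose k) * X ^ k

theorem mul_derivative_pow {R : Type*} [CommRing R] (y : R[X]) (k : ℕ) :
    y * derivative (y ^ k) = k * y ^ k * derivative y := by
  cases k with
  | zero => simp
  | succ k => rw [derivative_pow_succ]; simp; ring

theorem add_choose_succ_mul (n k : ℕ) :
    ((n + (k + 1)).choose (k + 1) : ℤ) * (k + 1) = (n + k + 1) * (n + k).choose k := by
  have := Nat.add_one_mul_choose_eq (n + k) k
  push_cast [← @Nat.cast_inj ℤ] at this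
  rw [← add_assoc, ← this]

theorem legendreShift_ode (n : ℕ) :
    (X ^ 2 + X) * derivative (derivative (legendreShift n))
      + (2 * X + 1) * derivative (legendreShift n) = (n : ℤ[X]) * ((n : ℤ[X]) + 1) * legendreShift n := by
  rw [← sub_eq_zero]
  apply (mul_eq_zero_iff_left (X_ne_zero (R := ℤ))).1
  let f : ℕ → ℤ := fun k => (n.choose k : ℤ) * (n + k).choose k
  have hf (k : ℕ) : f (k + 1) * (k + 1) ^ 2 = (n - k) * (n + k + 1) * f k := by
    have h1 := choose_succ_right_mul_int n k
    have h2 := add_choose_succ_mul n k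
    simp only [f]
    linear_combination ((n + (k + 1)).choose (k + 1) : ℤ) * (k + 1) * h1
      + (n.choose k : ℤ) * (n - k) * h2
  have key (k : ℕ) : X * ((X ^ 2 + X) * derivative (derivative (C (f k) * X ^ k))
      + (2 * X + 1) * derivative (C (f k) * X ^ k) - (n : ℤ[X]) * ((n : ℤ[X]) + 1) * (C (f k) * X ^ k))
      = C (f k * k ^ 2) * X ^ k - C (f (k + 1) * (k + 1 : ℕ) ^ 2) * X ^ (k + 1) := by
    have e1 := mul_derivative_pow (X : ℤ[X]) k
    have e2 := congrArg derivative e1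
    simp only [derivative_mul, derivative_X, derivative_natCast, derivative_one] at e2
    push_cast
    rw [hf, derivative_C_mul, derivative_C_mul, pow_succ _ k]
    simp only [derivative_X] at e1
    generalize derivative (derivative (X ^ k : ℤ[X])) = d2 at *
    generalize derivative (X ^ k : ℤ[X]) = d1 at *
    generalize (X ^ k : ℤ[X]) = Q at *
    simp only [C_mul, C_sub, C_add, C_pow, C_1, map_natCast]
    linear_combination C (f k) * ((X * (X + 1)) * e2 + ((k : ℤ[X]) * (X + 1) + X) * e1)
  have hsum : X * ((X ^ 2 + X) * derivative (derivative (legendreShift n))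
      + (2 * X + 1) * derivative (legendreShift n) - (n : ℤ[X]) * ((n : ℤ[X]) + 1) * legendreShift n) =
      ∑ k ∈ range (n + 1), (C (f k * k ^ 2) * X ^ k - C (f (k + 1) * (k + 1 : ℕ) ^ 2) * X ^ (k + 1)) := by
    rw [← sum_congr rfl fun k _ => key k]
    simp only [legendreShift, derivative_sum, mul_sum, ← sum_add_distrib, ← sum_sub_distrib, f]
  rw [hsum, sum_range_sub' (fun k => C (f k * (k : ℕ) ^ 2) * (X : ℤ[X]) ^ k)]
  simp [f]

/-- The symmetric square of the differential operator annihilating `legendreShift n`. -/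
noncomputable def symSquareOp (n : ℕ) (G : ℤ[X]) : ℤ[X] :=
  (X ^ 2 + X) ^ 2 * derivative (derivative (derivative G))
    + 3 * (X ^ 2 + X) * (2 * X + 1) * derivative (derivative G)
    + (1 + 6 * (X ^ 2 + X)) * derivative G
    - 4 * ((n : ℤ[X]) * ((n : ℤ[X]) + 1)) * (X ^ 2 + X) * derivative G
    - 2 * ((n : ℤ[X]) * ((n : ℤ[X]) + 1)) * (2 * X + 1) * G

theorem symSquareOp_legendreShift_sq (n : ℕ) : symSquareOp n (legendreShift n ^ 2) = 0 := by
  have e := legendreShift_ode n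
  have e' := congrArg derivative e
  generalize legendreShift n = F at *
  rw [symSquareOp, sq F]
  simp only [derivative_mul, derivative_add, derivative_X, derivative_natCast, derivative_one,
    derivative_X_pow, derivative_ofNat, map_natCast] at *
  generalize derivative (derivative (derivative F)) = F3 at *
  generalize derivative (derivative F) = F2 at *
  generalize derivative F = F1 at *
  simp at *
  linear_combination 2 * (X ^ 2 + X) * F * e' + (6 * (X ^ 2 + X) * F1 + 2 * (2 * X + 1) * F) * e

theorem symSquareOp_clausen (n : ℕ) :
    symSquareOp n (∑ k ∈ range (n + 1),
      C (((2 * k).choose k : ℤ) ^ 2 * (n + k).choose (2 * k)) * (X ^ 2 + X) ^ k) = 0 := by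
  have hy : (X ^ 2 + X : ℤ[X]) ≠ 0 := by
    intro h
    have := congrArg (eval 1) h
    simp at this
  apply (mul_eq_zero_iff_left hy).1
  let f : ℕ → ℤ := fun k => ((2 * k).choose k : ℤ) ^ 2 * (n + k).choose (2 * k)
  have hf (k : ℕ) : f (k + 1) * (k + 1) ^ 3 = (4 * k + 2) * ((n - k) * (n + k + 1)) * f k := by
    have h1 := choose_succ_right_mul_int (n + k + 1) (2 * k + 1)
    have h2 := Nat.add_one_mul_choose_eq (n + k) (2 * k)
    have h3 := Nat.succ_mul_centralBinom_succ k
    simp only [Nat.centralBinom_eq_two_mul_choose] at h3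
    push_cast [← @Nat.cast_inj ℤ] at h1 h2 h3
    simp only [f]
    rw [show n + (k + 1) = n + k + 1 by ring]
    rw [show 2 * (k + 1) = 2 * k + 1 + 1 by ring] at *
    generalize ((n + k + 1).choose (2 * k + 1 + 1) : ℤ) = w at *
    generalize ((n + k + 1).choose (2 * k + 1) : ℤ) = v at *
    generalize ((n + k).choose (2 * k) : ℤ) = t at *
    generalize ((2 * k + 1 + 1).choose (k + 1) : ℤ) = b at *
    generalize ((2 * k).choose k : ℤ) = a at *
    linear_combination w * (k + 1 : ℤ) * (b * (k + 1) + 2 * (2 * k + 1) * a) * h3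
      + 2 * (2 * k + 1) ^ 2 * a ^ 2 * h1 - 2 * (2 * k + 1 : ℤ) * a ^ 2 * (n - k) * h2
  have key (k : ℕ) : (X ^ 2 + X) * symSquareOp n (C (f k) * (X ^ 2 + X) ^ k)
      = (2 * X + 1) * (C (f k * k ^ 3) * (X ^ 2 + X) ^ k
        - C (f (k + 1) * (k + 1 : ℕ) ^ 3) * (X ^ 2 + X) ^ (k + 1)) := by
    have e1 := mul_derivative_pow (X ^ 2 + X : ℤ[X]) k
    have hd : derivative (X ^ 2 + X : ℤ[X]) = 2 * X + 1 := by simp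
    have e2 := congrArg derivative e1
    have e3 := congrArg derivative e2
    push_cast
    rw [hf, symSquareOp, derivative_C_mul, derivative_C_mul, derivative_C_mul, pow_succ _ k]
    simp only [derivative_mul, hd, derivative_natCast, derivative_one, derivative_add,
      derivative_X, derivative_ofNat, derivative_zero] at e1 e2 e3
    generalize derivative (derivative (derivative ((X ^ 2 + X) ^ k : ℤ[X]))) = d3 at *
    generalize derivative (derivative ((X ^ 2 + X) ^ k : ℤ[X])) = d2 at *
    generalize derivative ((X ^ 2 + X) ^ k : ℤ[X]) = d1 at *
    generalize ((X ^ 2 + X) ^ k : ℤ[X]) = Q at *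
    simp only [C_mul, C_sub, C_add, C_pow, C_1, map_natCast, C_ofNat]
    linear_combination C (f k) * ((X ^ 2 + X) ^ 2 * e3
      + ((k : ℤ[X]) + 1) * (2 * X + 1) * (X ^ 2 + X) * e2
      + ((k : ℤ[X]) ^ 2 * (2 * X + 1) ^ 2 + (X ^ 2 + X) * (4 * k - 4 * ((n : ℤ[X]) * ((n : ℤ[X]) + 1)))) * e1)
  have hsum : (X ^ 2 + X) * symSquareOp n (∑ k ∈ range (n + 1), C (f k) * (X ^ 2 + X) ^ k) =
      ∑ k ∈ range (n + 1), (2 * X + 1) * (C (f k * k ^ 3) * (X ^ 2 + X) ^ k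
        - C (f (k + 1) * (k + 1 : ℕ) ^ 3) * (X ^ 2 + X) ^ (k + 1)) := by
    rw [← sum_congr rfl fun k _ => key k]
    simp only [symSquareOp, derivative_sum, mul_sum, ← sum_add_distrib, ← sum_sub_distrib]
  rw [hsum, ← mul_sum, sum_range_sub' (fun k => C (f k * (k : ℕ) ^ 3) * (X ^ 2 + X : ℤ[X]) ^ k)]
  simp [f, Nat.choose_eq_zero_of_lt (show n + (n + 1) < 2 * (n + 1) by omega)]

theorem eq_zero_of_symSquareOp_eq_zero {n : ℕ} {G : ℤ[X]} (hG : symSquareOp n G = 0)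
    (h0 : G.coeff 0 = 0) : G = 0 := by
  have key (m : ℕ) : ∀ j ≤ m, G.coeff j = 0 := by
    induction m with
    | zero => simpa using h0
    | succ m ih =>
      intro j hj
      rcases hj.lt_or_eq with hj | rfl
      · exact ih j (by omega)
      have h := congrArg (fun P : ℤ[X] => coeff P m) hG
      obtain ⟨a, b, c, hexp⟩ : ∃ a b c : ℤ, symSquareOp n G =
          derivative (derivative (derivative G)) * X ^ 4
          + C 2 * (derivative (derivative (derivative G)) * X ^ 3)
          + derivative (derivative (derivative G)) * X ^ 2
          + C 6 * (derivative (derivative G) * X ^ 3) + C 9 * (derivative (derivative G) * X ^ 2)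
          + C 3 * (derivative (derivative G) * X ^ 1) + C a * (derivative G * X ^ 2)
          + C a * (derivative G * X ^ 1) + derivative G - C b * (G * X ^ 1) - C c * G := by
        refine ⟨6 - 4 * (n * (n + 1)), 4 * (n * (n + 1)), 2 * (n * (n + 1)), ?_⟩
        simp [symSquareOp]
        ring
      rw [hexp] at h
      have hc : G.coeff (m + 1) * ((m : ℤ) + 1) ^ 3 = 0 := by
        rcases m with _ | _ | _ | _ | m <;>
          simp only [coeff_add, coeff_sub, coeff_C_mul, coeff_mul_X_pow', coeff_derivative,
            coeff_zero] at h <;>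
          simp [ih] at h <;> simp only [add_assoc, Nat.reduceAdd] at h ⊢ <;> push_cast <;>
          linear_combination h
      exact (mul_eq_zero_iff_right (by positivity)).1 hc
  ext m
  simpa using key m m le_rfl

theorem legendreShift_sq (n : ℕ) :
    legendreShift n ^ 2 = ∑ k ∈ range (n + 1),
      C (((2 * k).choose k : ℤ) ^ 2 * (n + k).choose (2 * k)) * (X ^ 2 + X) ^ k := by
  rw [← sub_eq_zero]
  apply eq_zero_of_symSquareOp_eq_zero (n := n)
  · have h1 := symSquareOp_legendreShift_sq n
    have h2 := symSquareOp_clausen n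
    rw [← sub_eq_zero.2 (h1.trans h2.symm)]
    simp only [symSquareOp, derivative_sub]
    ring
  · rw [coeff_zero_eq_eval_zero]
    simp [legendreShift, eval_finsetSum, sum_range_succ']

end Clausen

section Evaluation

open Finset Polynomial

variable {A : Type*} [CommRing A]

theorem aeval_legendreShift (n : ℕ) (x : A) :
    aeval x (legendreShift n) =
      ∑ k ∈ range (n + 1), (n.choose k : A) * ((n + k).choose k : A) * x ^ k := by
  simp [legendreShift]

theorem aeval_legendreShift_symm (n : ℕ) (x : A) :
    aeval (-1 - x) (legendreShift n) = (-1) ^ n * aeval x (legendreShift n) := by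
  have h (y : A) : aeval y (legendreShift n) = aeval (-y) (shiftedLegendre n) := by
    rw [aeval_legendreShift, shiftedLegendre, map_sum]
    refine sum_congr rfl fun k _ => ?_
    rw [Nat.choose_symm_add]
    simp only [map_mul, map_pow, map_neg, map_one, aeval_X, map_natCast, neg_pow y]
    have := congrArg (Int.cast : ℤ → A) (pow_mul_pow_eq_one k (show (-1 : ℤ) * -1 = 1 by norm_num))
    push_cast at this
    linear_combination (-(n.choose k : A) * ((n + k).choose k : A) * y ^ k) * this
  rw [h, h, shiftedLegendre_eval_symm n (-x)]
  rw [← mul_assoc, pow_mul_pow_eq_one n (by norm_num : (-1 : A) * -1 = 1), one_mul]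
  congr 2
  ring

theorem intCast_clausen_sum_eq (n : ℕ) {ω : A} (hω : ω ^ 2 + ω + 1 = 0) :
    ((∑ k ∈ range (n + 1), ((2 * k).choose k : ℤ) ^ 2 * (n + k).choose (2 * k) * (-1) ^ k : ℤ) : A)
      = aeval ω (legendreShift n) ^ 2 := by
  rw [← map_pow, legendreShift_sq]
  simp [show ω ^ 2 + ω = -1 by linear_combination hω]

theorem natCast_add_choose_eq {n p k : ℕ} (hp : p.Prime) (hn : p = 2 * n + 1) (hpA : (p : A) = 0)
    (hk : k ≤ n) : ((n + k).choose k : A) = (-1) ^ k * n.choose k := by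
  suffices h : (p : ℤ) ∣ (n + k).choose k - (-1) ^ k * n.choose k by
    obtain ⟨c, hc⟩ := h
    have := congrArg (Int.cast : ℤ → A) hc
    push_cast at this
    rwa [hpA, zero_mul, sub_eq_zero] at this
  induction k with
  | zero => simp
  | succ k ih =>
    obtain ⟨c, hc⟩ := ih (by omega)
    have hcop : IsCoprime ((k + 1 : ℕ) : ℤ) p :=
      (isCoprime_sq_of_pos_of_lt hp (Nat.succ_pos k) (by omega)).of_isCoprime_of_dvd_right
        (dvd_pow_self _ two_ne_zero)
    refine hcop.symm.dvd_of_dvd_mul_right ?_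
    have h1 := choose_succ_right_mul_int n k
    have h2 := add_choose_succ_mul n k
    refine ⟨(-1) ^ k * n.choose k + (n + k + 1) * c, ?_⟩
    rw [hn] at *
    push_cast at *
    linear_combination h2 + (-1) ^ k * h1 + (n + k + 1 : ℤ) * hc

theorem aeval_legendreShift_of_char {n p : ℕ} (hp : p.Prime) (hn : p = 2 * n + 1)
    (hpA : (p : A) = 0) (x : A) :
    aeval x (legendreShift n) = ∑ k ∈ range (n + 1), (n.choose k : A) ^ 2 * (-x) ^ k := by
  rw [aeval_legendreShift]
  refine sum_congr rfl fun k hk => ?_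
  rw [natCast_add_choose_eq hp hn hpA (by simpa [Nat.lt_succ_iff] using hk), neg_pow x]
  ring

theorem sum_choose_sq_mul_pow_reflect (n : ℕ) {μ ν : A} (h : μ * ν = 1) :
    ∑ k ∈ range (n + 1), (n.choose k : A) ^ 2 * μ ^ k =
      μ ^ n * ∑ k ∈ range (n + 1), (n.choose k : A) ^ 2 * ν ^ k := by
  rw [← sum_range_reflect, mul_sum]
  refine sum_congr rfl fun k hk => ?_
  have hk : k ≤ n := by simpa [Nat.lt_succ_iff] using hk
  rw [show n + 1 - 1 - k = n - k by omega, Nat.choose_symm hk]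
  have h1 : μ ^ n = μ ^ (n - k) * μ ^ k := by rw [← pow_add, Nat.sub_add_cancel hk]
  have h2 := pow_mul_pow_eq_one k h
  rw [h1]
  linear_combination (-(n.choose k : A) ^ 2 * μ ^ (n - k)) * h2

theorem aeval_legendreShift_eq_zero {n p : ℕ} (hp : p.Prime) (hn : p = 2 * n + 1)
    (hpA : (p : A) = 0) (h3 : p % 3 = 2) {ω : A} (hω : ω ^ 2 + ω + 1 = 0) :
    aeval ω (legendreShift n) = 0 := by
  have hω3 : ω ^ 3 = 1 := by linear_combination (ω - 1) * hω
  have hωn : ω ^ n = ω ^ 2 := by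
    rw [← Nat.div_add_mod n 3, pow_add, pow_mul, hω3, one_pow, one_mul,
      show n % 3 = 2 by omega]
  have h1 := aeval_legendreShift_symm n ω
  rw [show -1 - ω = ω ^ 2 by linear_combination -hω] at h1
  have h2 := sum_choose_sq_mul_pow_reflect n (show -ω * -ω ^ 2 = 1 by linear_combination hω3)
  rw [← aeval_legendreShift_of_char hp hn hpA, ← aeval_legendreShift_of_char hp hn hpA, h1,
    neg_pow ω, hωn] at h2
  have h4 := pow_mul_pow_eq_one n (by norm_num : (-1 : A) * -1 = 1)
  have h5 : 3 * aeval ω (legendreShift n) = 0 := by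
    linear_combination (1 - ω) * h2 + (1 - ω) * ω ^ 2 * aeval ω (legendreShift n) * h4
      - aeval ω (legendreShift n) * (hω3 - hω)
  obtain ⟨q, hq⟩ : ∃ q, p = 3 * q + 2 := ⟨p / 3, by omega⟩
  rw [hq] at hpA
  push_cast at hpA
  linear_combination (q + 1 : A) * h5 - aeval ω (legendreShift n) * hpA

theorem QuadraticAlgebra.dvd_of_intCast_dvd {a b P T : ℤ}
    (h : (P : QuadraticAlgebra ℤ a b) ∣ T) : P ∣ T := by
  obtain ⟨c, hc⟩ := h
  exact ⟨c.re, by simpa using congrArg QuadraticAlgebra.re hc⟩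

theorem prime_sq_dvd_clausen_sum {n p : ℕ} (hp : p.Prime) (hn : p = 2 * n + 1)
    (h3 : p % 3 = 2) :
    (p : ℤ) ^ 2 ∣
      ∑ k ∈ range (n + 1), ((2 * k).choose k : ℤ) ^ 2 * (n + k).choose (2 * k) * (-1) ^ k := by
  let ω : QuadraticAlgebra ℤ (-1) (-1) := ⟨0, 1⟩
  have hω : ω ^ 2 + ω + 1 = 0 := by
    ext <;> simp [ω, sq, QuadraticAlgebra.re_one, QuadraticAlgebra.im_one]
  let I := Ideal.span {(p : QuadraticAlgebra ℤ (-1) (-1))}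
  have hdvd : (p : QuadraticAlgebra ℤ (-1) (-1)) ∣ aeval ω (legendreShift n) := by
    rw [← Ideal.mem_span_singleton, ← Ideal.Quotient.eq_zero_iff_mem]
    have hp0 : (p : QuadraticAlgebra ℤ (-1) (-1) ⧸ I) = 0 := by
      rw [← map_natCast (Ideal.Quotient.mk I), Ideal.Quotient.eq_zero_iff_mem]
      exact Ideal.mem_span_singleton_self _
    have hω' := congrArg (Ideal.Quotient.mk I) hω
    simp only [map_add, map_pow, map_one, map_zero] at hω'
    have := aeval_legendreShift_eq_zero hp hn hp0 h3 hω'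
    rw [aeval_legendreShift] at this ⊢
    simpa using this
  have h := pow_dvd_pow_of_dvd hdvd 2
  rw [← intCast_clausen_sum_eq n hω] at h
  rw [← Int.cast_natCast, ← Int.cast_pow] at h
  exact QuadraticAlgebra.dvd_of_intCast_dvd h

end Evaluation

section CubicSums

open Finset

variable {F : Type*} [Field F] [Fintype F] [DecidableEq F]

/-- The character sum `∑_z χ(z³ + m)` over a finite field, with `χ` the quadratic character. -/
def cubicCharSum (m : F) : ℤ := ∑ z : F, quadraticChar F (z ^ 3 + m)

theorem quadraticChar_cube (r : F) : quadraticChar F (r ^ 3) = quadraticChar F r := by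
  rcases eq_or_ne r 0 with rfl | hr
  · simp
  · rw [pow_succ, map_mul, quadraticChar_sq_one' hr, one_mul]

theorem cubicCharSum_mul_cube (m : F) {r : F} (hr : r ≠ 0) :
    cubicCharSum (m * r ^ 3) = quadraticChar F r * cubicCharSum m := by
  rw [cubicCharSum, cubicCharSum, mul_sum]
  refine (Fintype.sum_equiv (Equiv.mulLeft₀ r hr) _ _ fun z => ?_).symm
  rw [← quadraticChar_cube r, ← map_mul, Equiv.mulLeft₀_apply]
  congr 1
  ring

theorem cubicCharSum_zero (hF : ringChar F ≠ 2) : cubicCharSum (0 : F) = 0 := by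
  simp only [cubicCharSum, add_zero, quadraticChar_cube]
  exact quadraticChar_sum_zero hF

theorem sum_quadraticChar_add_mul_add (hF : ringChar F ≠ 2) (u v : F) :
    ∑ t : F, quadraticChar F (u + t) * quadraticChar F (v + t) =
      -1 + if u = v then (Fintype.card F : ℤ) else 0 := by
  split_ifs with h
  · subst h
    have h1 (t : F) : quadraticChar F (u + t) * quadraticChar F (u + t) =
        1 - if -u = t then 1 else 0 := by
      split_ifs with ht
      · simp [← ht]
      · rw [← sq, quadraticChar_sq_one (fun h => ht (neg_eq_of_add_eq_zero_right h)), sub_zero]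
    simp_rw [h1]
    simp [sum_sub_distrib]
    ring
  · have hd : v - u ≠ 0 := sub_ne_zero.2 (Ne.symm h)
    have hJ := jacobiSum_nontrivial_inv (quadraticChar_ne_one hF)
    rw [(quadraticChar_isQuadratic F).inv, jacobiSum] at hJ
    have h1 : quadraticChar F (-1) * quadraticChar F (-1) = 1 := by
      rw [← sq, quadraticChar_sq_one (neg_ne_zero.2 one_ne_zero)]
    have h2 : quadraticChar F (v - u) * quadraticChar F (v - u) = 1 := by
      rw [← sq, quadraticChar_sq_one hd]
    have key : quadraticChar F (-1) *
        ∑ x : F, quadraticChar F x * quadraticChar F (1 - x) =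
        ∑ t : F, quadraticChar F (u + t) * quadraticChar F (v + t) := by
      rw [mul_sum]
      refine Fintype.sum_equiv ((Equiv.mulLeft₀ (-(v - u)) (neg_ne_zero.2 hd)).trans
        (Equiv.subRight u)) _ _ fun x => ?_
      have e1 : u + (-(v - u) * x - u) = -1 * ((v - u) * x) := by ring
      have e2 : v + (-(v - u) * x - u) = (v - u) * (1 - x) := by ring
      simp only [Equiv.trans_apply, Equiv.mulLeft₀_apply, Equiv.subRight_apply]
      rw [e1, e2, map_mul, map_mul, map_mul]
      linear_combination (-quadraticChar F (-1) * quadraticChar F x * quadraticChar F (1 - x)) * h2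
    rw [← key, hJ]
    linear_combination -h1

theorem card_filter_cube_eq {ω : F} (hω : ω ^ 2 + ω + 1 = 0) (h3 : (3 : F) ≠ 0) {z : F}
    (hz : z ≠ 0) : #{w : F | z ^ 3 = w ^ 3} = 3 := by
  have hω1 : ω ≠ 1 := by
    rintro rfl
    exact h3 (by linear_combination hω)
  have hω0 : ω ≠ 0 := by
    rintro rfl
    simp at hω
  have : ({w : F | z ^ 3 = w ^ 3} : Finset F) = {z, ω * z, ω ^ 2 * z} := by
    ext w
    simp only [mem_filter, mem_univ, true_and, mem_insert, mem_singleton]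
    constructor
    · intro h
      have : (w - z) * ((w - ω * z) * (w - ω ^ 2 * z)) = 0 := by
        linear_combination -h + (w * z * (z - w) + z ^ 2 * (ω - 1) * (w - z)) * hω
      simpa [sub_eq_zero] using this
    · rintro (rfl | rfl | rfl)
      · rfl
      · linear_combination (-(ω - 1) * z ^ 3) * hω
      · linear_combination (-(ω ^ 3 + 1) * (ω - 1) * z ^ 3) * hω
  rw [this, card_eq_three]
  refine ⟨z, ω * z, ω ^ 2 * z, fun h => ?_, fun h => ?_, fun h => ?_, rfl⟩
  · exact hω1 (mul_right_cancel₀ hz (by rw [← h, one_mul]))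
  · have h1 : ω ^ 2 = 1 := mul_right_cancel₀ hz (by rw [← h, one_mul])
    have h2 : ω = -2 := by linear_combination hω - h1
    rw [h2] at h1
    exact h3 (by linear_combination h1)
  · have := mul_right_cancel₀ hz h
    exact hω1 (mul_left_cancel₀ hω0 (by linear_combination -this))

theorem sum_cubicCharSum_sq (hF : ringChar F ≠ 2) {ω : F} (hω : ω ^ 2 + ω + 1 = 0)
    (h3 : (3 : F) ≠ 0) :
    ∑ m : F, cubicCharSum m ^ 2 = 2 * Fintype.card F * (Fintype.card F - 1) := by
  have h1 : ∑ m : F, cubicCharSum m ^ 2 = ∑ z : F, ∑ w : F, ∑ m : F,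
      quadraticChar F (z ^ 3 + m) * quadraticChar F (w ^ 3 + m) := by
    simp only [cubicCharSum, sq, sum_mul_sum]
    rw [sum_comm]
    exact sum_congr rfl fun z _ => sum_comm
  have h2 (z : F) : ∑ w : F, ∑ m : F,
      quadraticChar F (z ^ 3 + m) * quadraticChar F (w ^ 3 + m) =
      2 * Fintype.card F - if 0 = z then 2 * (Fintype.card F : ℤ) else 0 := by
    simp_rw [sum_quadraticChar_add_mul_add hF, sum_add_distrib, ← sum_filter, sum_const]
    split_ifs with hz
    · subst hz
      have : ({w : F | (0 : F) ^ 3 = w ^ 3} : Finset F) = {0} := by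
        ext w
        simp [eq_comm (a := (0 : F))]
      rw [this]
      simp
    · rw [card_filter_cube_eq hω h3 (Ne.symm hz)]
      simp
      ring
  rw [h1]
  simp_rw [h2]
  simp [sum_sub_distrib]
  ring

theorem sum_quadraticChar_mul_cubicCharSum (hF : ringChar F ≠ 2) :
    ∑ m : F, quadraticChar F m * cubicCharSum m = 0 := by
  have h1 : ∑ m : F, quadraticChar F m * cubicCharSum m = ∑ z : F, ∑ m : F,
      quadraticChar F (0 + m) * quadraticChar F (z ^ 3 + m) := by
    simp only [cubicCharSum, mul_sum, zero_add]
    exact sum_comm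
  rw [h1]
  simp_rw [sum_quadraticChar_add_mul_add hF]
  simp [sum_add_distrib, eq_comm (a := (0 : F))]

theorem even_cubicCharSum_one (hF : ringChar F ≠ 2) {ω : F} (hω : ω ^ 2 + ω + 1 = 0)
    (h3 : (3 : F) ≠ 0) : Even (cubicCharSum (1 : F)) := by
  have h (t : F) : Even (quadraticChar F t - (1 - if t = 0 then 1 else 0)) := by
    split_ifs with ht
    · simp [ht]
    · rcases quadraticChar_dichotomy ht with h | h <;> simp [h]
  have hsum : Even (∑ z : F, (quadraticChar F (z ^ 3 + 1) - (1 - if z ^ 3 + 1 = 0 then 1 else 0))) :=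
    Finset.even_sum _ fun z _ => h _
  have hc := card_filter_cube_eq hω h3 (neg_ne_zero.2 (one_ne_zero (α := F)))
  have hc' : #{z : F | z ^ 3 + 1 = 0} = 3 := by
    refine (congrArg card (filter_congr fun z _ => ?_)).trans hc
    constructor <;> intro h <;> linear_combination -h
  rw [sum_sub_distrib, sum_sub_distrib, sum_boole, hc'] at hsum
  have hodd : Odd (Fintype.card F) :=
    Nat.odd_iff.2 (FiniteField.odd_card_of_char_ne_two hF)
  simp only [sum_const, card_univ, nsmul_eq_mul, mul_one] at hsum
  change Even (cubicCharSum (1 : F) - ((Fintype.card F : ℤ) - 3)) at hsum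
  have hodd' : Odd (Fintype.card F : ℤ) := by exact_mod_cast hodd
  have : Even ((Fintype.card F : ℤ) - 3) := hodd'.sub_odd (by decide)
  simpa using hsum.add this

theorem sum_range_three_mul_of_periodic (h : ℕ → ℤ) (hh : ∀ i, h (i + 3) = h i) (q : ℕ) :
    ∑ i ∈ range (3 * q), h i = q * (h 0 + h 1 + h 2) := by
  have hp (q i : ℕ) : h (3 * q + i) = h i := by
    induction q with
    | zero => simp
    | succ q ih => rw [← ih, ← hh (3 * q + i)]; congr 1; ring
  induction q with
  | zero => simp
  | succ q ih =>
    rw [show 3 * (q + 1) = 3 * q + 1 + 1 + 1 by ring, sum_range_succ, sum_range_succ,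
      sum_range_succ, ih, hp q 1, hp q 2, show h (3 * q) = h 0 from hp q 0]
    push_cast
    ring

theorem sum_eq_sum_range_pow_generator {f : F → ℤ} (h0 : f 0 = 0) {g : Fˣ}
    (hg : ∀ x, x ∈ Subgroup.zpowers g) :
    ∑ m : F, f m = ∑ i ∈ range (Fintype.card F - 1), f ((g : F) ^ i) := by
  have hcard : orderOf g = Fintype.card F - 1 := by
    rw [orderOf_eq_card_of_forall_mem_zpowers hg, Nat.card_eq_fintype_card, Fintype.card_units]
  rw [← sum_image (g := fun i => (g : F) ^ i)]
  · refine (sum_subset (subset_univ _) fun x _ hx => ?_).symm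
    by_contra hfx
    have hx0 : x ≠ 0 := fun h => hfx (h ▸ h0)
    obtain ⟨i, hi, hgi⟩ := mem_image.1 <|
      (IsCyclic.image_range_orderOf hg).symm ▸ mem_univ (Units.mk0 x hx0)
    refine hx (mem_image.2 ⟨i, hcard ▸ hi, ?_⟩)
    rw [← Units.val_pow_eq_pow_val, hgi, Units.val_mk0]
  · intro i hi j hj hij
    rw [coe_range, ← hcard] at hi hj
    exact pow_injOn_Iio_orderOf hi hj (Units.ext (by simpa using hij))

theorem exists_cubicCharSum_one (hF : ringChar F ≠ 2) {ω : F} (hω : ω ^ 2 + ω + 1 = 0)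
    (h3 : (3 : F) ≠ 0) (hq : Fintype.card F % 3 = 1) :
    ∃ a d : ℤ, cubicCharSum (1 : F) = 2 * a ∧ a ^ 2 + 3 * d ^ 2 = Fintype.card F := by
  obtain ⟨g, hg⟩ := IsCyclic.exists_generator (α := Fˣ)
  have hg0 : (g : F) ≠ 0 := g.ne_zero
  obtain ⟨q, hq⟩ : ∃ q, Fintype.card F = 3 * q + 1 := ⟨Fintype.card F / 3, by omega⟩
  have hqpos : 0 < q := by
    have := Fintype.one_lt_card (α := F)
    omega
  let T : ℕ → ℤ := fun i => quadraticChar F ((g : F) ^ i) * cubicCharSum ((g : F) ^ i)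
  have hper (i : ℕ) : T (i + 3) = T i := by
    simp only [T]
    rw [pow_add, cubicCharSum_mul_cube _ hg0, map_mul, quadraticChar_cube]
    linear_combination quadraticChar F ((g : F) ^ i) * cubicCharSum ((g : F) ^ i) *
      quadraticChar_sq_one hg0
  have hT (i : ℕ) : T i ^ 2 = cubicCharSum ((g : F) ^ i) ^ 2 := by
    simp only [T]
    rw [mul_pow, quadraticChar_sq_one (pow_ne_zero i hg0), one_mul]
  have e1 := sum_quadraticChar_mul_cubicCharSum hF
  rw [sum_eq_sum_range_pow_generator (by simp) hg, hq, Nat.add_sub_cancel] at e1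
  have e2 := sum_cubicCharSum_sq hF hω h3
  rw [sum_eq_sum_range_pow_generator (by simp [cubicCharSum_zero hF]) hg, hq,
    Nat.add_sub_cancel] at e2
  simp_rw [← hT] at e2
  rw [sum_range_three_mul_of_periodic T hper] at e1
  rw [sum_range_three_mul_of_periodic (fun i => T i ^ 2) (fun i => by rw [hper])] at e2
  have hq0 : (q : ℤ) ≠ 0 := by exact_mod_cast hqpos.ne'
  have hT0 : T 0 = cubicCharSum (1 : F) := by simp [T]
  have e1' : T 0 + T 1 + T 2 = 0 := (mul_eq_zero_iff_left hq0).1 e1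
  have e2' : T 0 ^ 2 + T 1 ^ 2 + T 2 ^ 2 = 6 * Fintype.card F := by
    apply mul_left_cancel₀ hq0
    rw [e2, hq]
    push_cast
    ring
  obtain ⟨a, ha⟩ := even_cubicCharSum_one hF hω h3
  rw [← hT0] at ha ⊢
  have hT2 : T 2 = -T 0 - T 1 := by linear_combination e1'
  rw [hT2, ha] at e2'
  have hdvd : (3 : ℤ) ∣ (T 1 + a) := by
    refine Int.prime_three.dvd_of_dvd_pow (n := 2) ?_
    exact ⟨Fintype.card F - a ^ 2, by linarith⟩
  obtain ⟨d, hd⟩ := hdvd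
  refine ⟨a, d, by rw [ha]; ring, ?_⟩
  rw [show T 1 = 3 * d - a by linarith] at e2'
  linarith

end CubicSums

section PrimeOneModThree

open Finset Polynomial

theorem FiniteField.sum_pow_eq_ite {F : Type*} [Field F] [Fintype F] {e : ℕ} (he : e ≠ 0) :
    ∑ x : F, x ^ e = if Fintype.card F - 1 ∣ e then -1 else 0 := by
  classical
  rw [← FiniteField.sum_pow_units F e, ← sum_subset (subset_univ ({0}ᶜ : Finset F))
    fun x _ hx => by simp_all]
  refine (sum_bij (fun (x : Fˣ) _ => (x : F)) (by simp) (fun _ _ _ _ h => Units.ext h)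
    (fun x hx => ⟨Units.mk0 x (by simpa using hx), mem_univ _, rfl⟩) fun _ _ => ?_).symm
  simp

theorem sum_legendreCubic_pow {F : Type*} [Field F] [Fintype F] {n : ℕ} (hn : 0 < n)
    (hF : Fintype.card F = 2 * n + 1) (a : F) :
    ∑ x : F, (x * (x + 1) * (x - a)) ^ n =
      -∑ k ∈ range (n + 1), (n.choose k : F) ^ 2 * (-a) ^ k := by
  have h (x : F) : (x * (x + 1) * (x - a)) ^ n = ∑ i ∈ range (n + 1), ∑ j ∈ range (n + 1),
      (n.choose i : F) * n.choose j * (-a) ^ j * x ^ (n + i + (n - j)) := by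
    rw [mul_pow, mul_pow, add_pow, show x - a = -a + x by ring, add_pow, mul_assoc, sum_mul_sum,
      mul_sum]
    refine sum_congr rfl fun i _ => ?_
    rw [mul_sum]
    refine sum_congr rfl fun j _ => ?_
    rw [pow_add, pow_add, one_pow]
    ring
  simp_rw [h]
  rw [sum_comm, ← sum_neg_distrib]
  refine sum_congr rfl fun i hi => ?_
  rw [sum_comm, sum_eq_single_of_mem i hi]
  · rw [mem_range] at hi
    rw [← mul_sum, FiniteField.sum_pow_eq_ite (by omega), if_pos ⟨1, by omega⟩]
    ring
  · intro j hj hji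
    rw [mem_range] at hi hj
    rw [← mul_sum, FiniteField.sum_pow_eq_ite (by omega), if_neg, mul_zero]
    rintro ⟨c, hc⟩
    rw [hF, Nat.add_sub_cancel] at hc
    obtain rfl | rfl | hc' : c = 0 ∨ c = 1 ∨ 2 ≤ c := by omega
    · omega
    · omega
    · have := Nat.mul_le_mul_left (2 * n) hc'
      omega

theorem aeval_legendreShift_sq_eq_cubicCharSum {n p : ℕ} [Fact p.Prime] (hn : p = 2 * n + 1)
    (hpos : 0 < n) {ω : ZMod p} (hω : ω ^ 2 + ω + 1 = 0) (h3 : (3 : ZMod p) ≠ 0) :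
    aeval ω (legendreShift n) ^ 2 = (cubicCharSum (1 : ZMod p) : ZMod p) ^ 2 := by
  have hp : p.Prime := Fact.out
  have hF : ringChar (ZMod p) ≠ 2 := by
    rw [ZMod.ringChar_zmod_n]
    omega
  obtain ⟨s, hs⟩ : ∃ s, ω - 1 = 3 * s := ⟨(ω - 1) / 3, by field_simp⟩
  have hs0 : s ≠ 0 := by
    rintro rfl
    apply h3
    linear_combination hω - (ω + 2) * hs
  have hω' : ω = 3 * s + 1 := by linear_combination hs
  have h3s : 3 * s ^ 2 + 3 * s + 1 = 0 := by
    apply mul_left_cancel₀ h3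
    rw [hω'] at hω
    linear_combination hω
  have key : ∑ x : ZMod p, (x * (x + 1) * (x - ω)) ^ n = (cubicCharSum (1 * s ^ 3) : ZMod p) := by
    rw [cubicCharSum, Int.cast_sum]
    refine Fintype.sum_equiv (Equiv.subRight s) _ _ fun x => ?_
    rw [quadraticChar_eq_pow_of_char_ne_two' hF, ZMod.card, show p / 2 = n by omega]
    congr 1
    rw [hω', Equiv.subRight_apply]
    linear_combination (-x) * h3s
  rw [aeval_legendreShift_of_char hp hn (ZMod.natCast_self p), ← neg_sq,
    ← sum_legendreCubic_pow hpos (by rw [ZMod.card, hn]), key, cubicCharSum_mul_cube _ hs0,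
    ← Int.cast_pow, ← Int.cast_pow, mul_pow, quadraticChar_sq_one hs0, one_mul]

theorem sq_eq_sq_of_add_three_mul_sq {p : ℕ} (hp : p.Prime) {a d x y : ℤ}
    (h1 : a ^ 2 + 3 * d ^ 2 = p) (h2 : (p : ℤ) = x ^ 2 + 3 * y ^ 2) : a ^ 2 = x ^ 2 := by
  have hp0 : (0 : ℤ) < p := by exact_mod_cast hp.pos
  have aux (d : ℤ) (h1 : a ^ 2 + 3 * d ^ 2 = p) (h : (p : ℤ) ∣ a * y - x * d) :
      a ^ 2 = x ^ 2 := by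
    obtain ⟨c, hc⟩ := h
    have e : (p : ℤ) ^ 2 = (a * x + 3 * d * y) ^ 2 + 3 * (p * c) ^ 2 := by
      rw [← hc, sq (p : ℤ)]
      nth_rw 1 [← h1]
      rw [h2]
      ring
    have hc0 : c = 0 := by
      by_contra hc0
      have : 0 < c ^ 2 := by positivity
      have : 1 ≤ c ^ 2 := this
      nlinarith [sq_nonneg (a * x + 3 * d * y), mul_pos hp0 hp0]
    rw [hc0, mul_zero] at hc
    refine mul_right_cancel₀ hp0.ne' ?_
    nth_rw 1 [h2]
    rw [← h1]
    linear_combination 3 * (a * y + x * d) * hc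
  have hdvd : (p : ℤ) ∣ (a * y - x * d) * (a * y - x * -d) :=
    ⟨y ^ 2 - d ^ 2, by linear_combination y ^ 2 * h1 + d ^ 2 * h2⟩
  rcases (Nat.prime_iff_prime_int.1 hp).dvd_or_dvd hdvd with h | h
  · exact aux d h1 h
  · exact aux (-d) (by rwa [neg_sq]) h

theorem clausen_sum_modEq {n p : ℕ} (hp : p.Prime) (hn : p = 2 * n + 1) (hp3 : p % 3 = 1)
    {x y : ℤ} (hxy : (p : ℤ) = x ^ 2 + 3 * y ^ 2) :
    ∑ k ∈ range (n + 1), ((2 * k).choose k : ℤ) ^ 2 * (n + k).choose (2 * k) * (-1) ^ k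
      ≡ 4 * x ^ 2 - 2 * p [ZMOD (p : ℤ)] := by
  have : Fact p.Prime := ⟨hp⟩
  have hn0 : 0 < n := by
    have := hp.one_lt
    omega
  have h2 : (2 : ZMod p) ≠ 0 := fun h => by
    have := (Nat.prime_dvd_prime_iff_eq hp Nat.prime_two).1
      ((ZMod.natCast_eq_zero_iff 2 p).1 (by exact_mod_cast h))
    omega
  have h3 : (3 : ZMod p) ≠ 0 := fun h => by
    have := (Nat.prime_dvd_prime_iff_eq hp Nat.prime_three).1
      ((ZMod.natCast_eq_zero_iff 3 p).1 (by exact_mod_cast h))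
    omega
  have hxy' : (x : ZMod p) ^ 2 + 3 * (y : ZMod p) ^ 2 = 0 := by
    have := congrArg (Int.cast : ℤ → ZMod p) hxy
    push_cast at this
    rw [← this, ZMod.natCast_self]
  have hy : (y : ZMod p) ≠ 0 := by
    intro hy
    have hx : (x : ZMod p) = 0 := by simpa [hy] using hxy'
    rw [ZMod.intCast_zmod_eq_zero_iff_dvd] at hx hy
    have hdvd : (p : ℤ) ^ 2 ∣ p := by
      conv_rhs => rw [hxy]
      exact dvd_add (pow_dvd_pow_of_dvd hx 2) ((pow_dvd_pow_of_dvd hy 2).mul_left 3)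
    have := Int.le_of_dvd (by exact_mod_cast hp.pos) hdvd
    have : (1 : ℤ) < p := by exact_mod_cast hp.one_lt
    nlinarith
  obtain ⟨ω, hω⟩ : ∃ ω : ZMod p, ω ^ 2 + ω + 1 = 0 := by
    refine ⟨(x / y - 1) / 2, ?_⟩
    field_simp
    linear_combination hxy'
  obtain ⟨a, d, ha, had⟩ := exists_cubicCharSum_one
    (by rw [ZMod.ringChar_zmod_n]; omega) hω h3 (by rwa [ZMod.card])
  rw [ZMod.card] at had
  rw [← ZMod.intCast_eq_intCast_iff, intCast_clausen_sum_eq n hω,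
    aeval_legendreShift_sq_eq_cubicCharSum hn hn0 hω h3, ha,
    ← sq_eq_sq_of_add_three_mul_sq hp had hxy]
  push_cast
  rw [ZMod.natCast_self]
  ring

end PrimeOneModThree

/-- For an odd prime `p`: if `p ≡ 1 (mod 3)` and `p = x² + 3y²`, then
`∑_{k=0}^{p-1} (-1)^k A_k ≡ 4x² - 2p (mod p)`; if `p ≡ 2 (mod 3)`, then
`∑_{k=0}^{p-1} (-1)^k A_k ≡ 0 (mod p²)`. -/
theorem sum_neg_one_pow_apery_num (p : ℕ) (hp : p.Prime) (hp2 : p ≠ 2) :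
    (p % 3 = 1 → ∀ x y : ℤ, (p : ℤ) = x ^ 2 + 3 * y ^ 2 →
      (∑ k ∈ Finset.range p, (-1 : ℤ) ^ k * aperyNum k) ≡ 4 * x ^ 2 - 2 * p [ZMOD (p : ℤ)]) ∧
    (p % 3 = 2 →
      (∑ k ∈ Finset.range p, (-1 : ℤ) ^ k * aperyNum k) ≡ 0 [ZMOD (p : ℤ) ^ 2]) := by
  obtain ⟨n, hn⟩ : ∃ n, p = 2 * n + 1 := hp.odd_of_ne_two hp2
  have h := sum_neg_one_pow_mul_aperyNum_modEq hp hn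
  exact ⟨fun h3 x y hxy => (h.of_dvd (dvd_pow_self _ two_ne_zero)).trans
      (clausen_sum_modEq hp hn h3 hxy),
    fun h3 => h.trans (Int.modEq_zero_iff_dvd.2 (prime_sq_dvd_clausen_sum hp hn h3))⟩
end

section
/- Let p be an odd prime and let x be a p-adic integer. If x ≡ 2k (mod p) for some k ∈ {0, 1, …, (p-1)/2}, then ∑_{r=0}^{p-1} (-1)^r C(x,r)² ≡ (-1)^k C(x,k) (mod p²), where the congruence is in the ring ℤ_p of p-adic integers. -/
/-- The generalized binomial coefficient `C(x,r) = x(x-1)⋯(x-r+1)/r!`. -/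
noncomputable def gchoose {K : Type*} [Field K] (x : K) (r : ℕ) : K :=
  (∏ i ∈ Finset.range r, (x - (i : K))) / (r.factorial : K)

section Field

variable {K : Type*} [Field K]

lemma gchoose_zero (x : K) : gchoose x 0 = 1 := by simp [gchoose]

lemma prod_range_succ_add_one_sub (x : K) (r : ℕ) :
    ∏ i ∈ Finset.range (r + 1), (x + 1 - (i : K)) =
      (x + 1) * ∏ i ∈ Finset.range r, (x - (i : K)) := by
  rw [Finset.prod_range_succ', mul_comm]
  congr 1
  · simp
  · refine Finset.prod_congr rfl fun i _ => ?_
    push_cast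
    ring

lemma add_one_mul_gchoose (x : K) (r : ℕ) :
    (x + 1) * gchoose x r = (x + 1 - r) * gchoose (x + 1) r := by
  have h := prod_range_succ_add_one_sub x r
  rw [Finset.prod_range_succ] at h
  simp only [gchoose, ← mul_div_assoc]
  rw [← h, mul_comm]

variable [CharZero K]

lemma gchoose_succ (x : K) (r : ℕ) :
    gchoose x (r + 1) = (x - r) * gchoose x r / (r + 1) := by
  have h1 : (r.factorial : K) ≠ 0 := Nat.cast_ne_zero.2 r.factorial_ne_zero
  have h2 : (r : K) + 1 ≠ 0 := Nat.cast_add_one_ne_zero r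
  simp only [gchoose, Finset.prod_range_succ, Nat.factorial_succ, Nat.cast_mul, Nat.cast_succ]
  field_simp

lemma gchoose_add_one_succ (x : K) (r : ℕ) :
    gchoose (x + 1) (r + 1) = (x + 1) * gchoose x r / (r + 1) := by
  have h1 : (r.factorial : K) ≠ 0 := Nat.cast_ne_zero.2 r.factorial_ne_zero
  have h2 : (r : K) + 1 ≠ 0 := Nat.cast_add_one_ne_zero r
  simp only [gchoose, prod_range_succ_add_one_sub, Nat.factorial_succ, Nat.cast_mul,
    Nat.cast_succ]
  field_simp

/-- The truncated alternating sum of squares `∑_{r < n} (-1)^r C(x,r)²`. -/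
noncomputable def altSumSq (x : K) (n : ℕ) : K :=
  ∑ r ∈ Finset.range n, (-1 : K) ^ r * gchoose x r ^ 2

/-- Truncated form of the recurrence in `x` for the alternating sum of squares. -/
lemma altSumSq_recurrence (x : K) (hx : x + 1 ≠ 0) (n : ℕ) :
    (x + 1) * ((x + 2) * altSumSq (x + 2) (n + 1) + 4 * (x + 1) * altSumSq x (n + 1)) =
      (-1) ^ n * (2 * n ^ 2 - 6 * (x + 1) * n + (x + 1) * (5 * x + 6)) *
        gchoose (x + 1) n ^ 2 := by
  induction n with
  | zero =>
    simp only [altSumSq, zero_add, Finset.sum_range_one, gchoose_zero, Nat.cast_zero]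
    ring
  | succ n ih =>
    have h2 : (n : K) + 1 ≠ 0 := Nat.cast_add_one_ne_zero n
    have e1 : gchoose (x + 2) (n + 1) = (x + 2) * gchoose (x + 1) n / (n + 1) := by
      have := gchoose_add_one_succ (x + 1) n
      rwa [show x + 1 + 1 = x + 2 by ring] at this
    have e2 := gchoose_succ (x + 1) n
    have e3 : gchoose x (n + 1) = (x - n) * gchoose (x + 1) (n + 1) / (x + 1) := by
      rw [eq_div_iff hx, mul_comm, add_one_mul_gchoose]
      push_cast
      ring
    have s (y : K) : altSumSq y (n + 1 + 1) =
        altSumSq y (n + 1) + (-1) ^ (n + 1) * gchoose y (n + 1) ^ 2 :=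
      Finset.sum_range_succ _ _
    rw [s, s, e1, e3, e2]
    trans (x + 1) * ((x + 2) * altSumSq (x + 2) (n + 1) + 4 * (x + 1) * altSumSq x (n + 1)) +
      (x + 1) * ((x + 2) * ((-1) ^ (n + 1) * ((x + 2) * gchoose (x + 1) n / (n + 1)) ^ 2) +
        4 * (x + 1) * ((-1) ^ (n + 1) *
          ((x - n) * ((x + 1 - n) * gchoose (x + 1) n / (n + 1)) / (x + 1)) ^ 2))
    · ring
    rw [ih]
    push_cast
    rw [pow_succ]
    field_simp
    ring

lemma add_two_mul_gchoose_sub (x : K) (k : ℕ) :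
    (x + 2) * gchoose (x + 2) (k + 1) - 4 * (x + 1) * gchoose x k =
      gchoose (x + 1) k * (x - 2 * k) ^ 2 / (k + 1) := by
  have h2 : (k : K) + 1 ≠ 0 := Nat.cast_add_one_ne_zero k
  have e1 : gchoose (x + 2) (k + 1) = (x + 2) * gchoose (x + 1) k / (k + 1) := by
    have := gchoose_add_one_succ (x + 1) k
    rwa [show x + 1 + 1 = x + 2 by ring] at this
  rw [mul_assoc 4, add_one_mul_gchoose, e1]
  field_simp
  ring

end Field

section Padic

variable {p : ℕ} [Fact p.Prime]

lemma Padic.norm_natCast_eq_one_of_lt {m : ℕ} (h0 : m ≠ 0) (hm : m < p) :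
    ‖(m : ℚ_[p])‖ = 1 := by
  rw [Padic.norm_natCast_eq_one_iff]
  exact Nat.coprime_of_lt_prime h0 hm Fact.out

lemma Padic.norm_factorial_eq_one {r : ℕ} (hr : r < p) : ‖(r.factorial : ℚ_[p])‖ = 1 := by
  rw [Padic.norm_natCast_eq_one_iff, (Fact.out : p.Prime).coprime_iff_not_dvd,
    (Fact.out : p.Prime).dvd_factorial]
  omega

lemma Padic.inv_prime_lt_one : (p : ℝ)⁻¹ < 1 :=
  inv_lt_one_of_one_lt₀ (by exact_mod_cast (Fact.out : p.Prime).one_lt)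

lemma Padic.norm_add_le_of_le {a b : ℚ_[p]} {c : ℝ} (ha : ‖a‖ ≤ c) (hb : ‖b‖ ≤ c) :
    ‖a + b‖ ≤ c :=
  (Padic.nonarchimedean a b).trans (max_le ha hb)

lemma Padic.norm_sub_le_of_le {a b : ℚ_[p]} {c : ℝ} (ha : ‖a‖ ≤ c) (hb : ‖b‖ ≤ c) :
    ‖a - b‖ ≤ c := by
  rw [sub_eq_add_neg]
  exact Padic.norm_add_le_of_le ha (by rwa [norm_neg])

lemma Padic.norm_natCast_le_one (n : ℕ) : ‖(n : ℚ_[p])‖ ≤ 1 := by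
  simpa using Padic.norm_int_le_one (p := p) n

lemma Padic.norm_le_one_of_norm_sub_natCast_le {x : ℚ_[p]} {m : ℕ}
    (h : ‖x - m‖ ≤ (p : ℝ)⁻¹) : ‖x‖ ≤ 1 := by
  simpa using Padic.norm_add_le_of_le (h.trans Padic.inv_prime_lt_one.le)
    (Padic.norm_natCast_le_one m)

lemma Padic.norm_eq_one_of_norm_sub_natCast_le {x : ℚ_[p]} {m : ℕ}
    (h0 : m ≠ 0) (hm : m < p) (h : ‖x - m‖ ≤ (p : ℝ)⁻¹) : ‖x‖ = 1 := by
  have h1 := Padic.norm_natCast_eq_one_of_lt h0 hm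
  have h2 := h.trans_lt Padic.inv_prime_lt_one
  have h3 := Padic.add_eq_max_of_ne (p := p) (q := x - m) (r := m) (by rw [h1]; exact h2.ne)
  rwa [sub_add_cancel, h1, max_eq_right h2.le] at h3

lemma norm_gchoose_le_one {x : ℚ_[p]} (hx : ‖x‖ ≤ 1) {r : ℕ} (hr : r < p) :
    ‖gchoose x r‖ ≤ 1 := by
  rw [gchoose, norm_div, Padic.norm_factorial_eq_one hr, div_one, norm_prod]
  exact Finset.prod_le_one (fun _ _ => norm_nonneg _) fun i _ =>
    Padic.norm_sub_le_of_le hx (Padic.norm_natCast_le_one i)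

lemma norm_gchoose_le_inv {x : ℚ_[p]} {m r : ℕ} (hmr : m < r) (hr : r < p)
    (h : ‖x - m‖ ≤ (p : ℝ)⁻¹) : ‖gchoose x r‖ ≤ (p : ℝ)⁻¹ := by
  have hx := Padic.norm_le_one_of_norm_sub_natCast_le h
  rw [gchoose, norm_div, Padic.norm_factorial_eq_one hr, div_one, norm_prod,
    ← Finset.mul_prod_erase _ _ (Finset.mem_range.2 hmr)]
  refine (mul_le_of_le_one_right (norm_nonneg _) ?_).trans h
  exact Finset.prod_le_one (fun _ _ => norm_nonneg _) fun i _ =>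
    Padic.norm_sub_le_of_le hx (Padic.norm_natCast_le_one i)

lemma norm_altSumSq_sub_one_le {x : ℚ_[p]} (hx : ‖x‖ ≤ (p : ℝ)⁻¹) :
    ‖altSumSq x p - 1‖ ≤ (p : ℝ)⁻¹ ^ 2 := by
  obtain ⟨n, hn⟩ := Nat.exists_eq_succ_of_ne_zero (Fact.out : p.Prime).ne_zero
  have h : altSumSq x p - 1 =
      ∑ r ∈ Finset.range n, (-1 : ℚ_[p]) ^ (r + 1) * gchoose x (r + 1) ^ 2 := by
    rw [altSumSq, show Finset.range p = Finset.range (n + 1) by rw [hn], Finset.sum_range_succ']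
    simp [gchoose_zero]
  rw [h]
  refine IsUltrametricDist.norm_sum_le_of_forall_le_of_nonneg (by positivity) fun r hr => ?_
  rw [Finset.mem_range] at hr
  simp only [norm_mul, norm_pow, norm_neg, norm_one, one_pow, one_mul]
  gcongr
  exact norm_gchoose_le_inv (m := 0) (by omega) (by omega) (by simpa using hx)

lemma norm_recurrence_coeff_le_one {x : ℚ_[p]} (hx : ‖x‖ ≤ 1) (n : ℕ) :
    ‖2 * (n : ℚ_[p]) ^ 2 - 6 * (x + 1) * n + (x + 1) * (5 * x + 6)‖ ≤ 1 := by
  let y : ℤ_[p] := ⟨x, hx⟩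
  have h := PadicInt.norm_le_one
    (2 * (n : ℤ_[p]) ^ 2 - 6 * (y + 1) * (n : ℤ_[p]) + (y + 1) * (5 * y + 6))
  rw [PadicInt.norm_def] at h
  push_cast at h
  exact h

theorem norm_altSumSq_sub_le (k : ℕ) (hk : 2 * k < p) (x : ℚ_[p])
    (hx : ‖x - 2 * k‖ ≤ (p : ℝ)⁻¹) :
    ‖altSumSq x p - (-1) ^ k * gchoose x k‖ ≤ (p : ℝ)⁻¹ ^ 2 := by
  induction k generalizing x with
  | zero => simpa [gchoose_zero] using norm_altSumSq_sub_one_le (x := x) (by simpa using hx)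
  | succ k ih =>
    obtain ⟨x, rfl⟩ : ∃ y, x = y + 2 := ⟨x - 2, by ring⟩
    have hx0 : ‖x - 2 * k‖ ≤ (p : ℝ)⁻¹ := by
      convert hx using 2
      push_cast
      ring
    have hx1 : ‖x + 1 - (2 * k + 1 : ℕ)‖ ≤ (p : ℝ)⁻¹ := by
      convert hx0 using 2
      push_cast
      ring
    have hx2 : ‖x + 2 - (2 * k + 2 : ℕ)‖ ≤ (p : ℝ)⁻¹ := by
      convert hx0 using 2
      push_cast
      ring
    have u1 : ‖x + 1‖ = 1 :=
      Padic.norm_eq_one_of_norm_sub_natCast_le (by omega) (by omega) hx1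
    have u2 : ‖x + 2‖ = 1 :=
      Padic.norm_eq_one_of_norm_sub_natCast_le (by omega) (by omega) hx2
    have hx3 : ‖x‖ ≤ 1 :=
      Padic.norm_le_one_of_norm_sub_natCast_le (m := 2 * k) (by simpa using hx0)
    have four_le : ‖(4 : ℚ_[p])‖ ≤ 1 := by exact_mod_cast Padic.norm_natCast_le_one (p := p) 4
    have hrec : ‖(x + 2) * altSumSq (x + 2) p + 4 * (x + 1) * altSumSq x p‖
        ≤ (p : ℝ)⁻¹ ^ 2 := by
      have hne : x + 1 ≠ 0 := norm_ne_zero_iff.1 (by rw [u1]; exact one_ne_zero)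
      have h := congrArg norm (altSumSq_recurrence x hne (p - 1))
      rw [Nat.sub_add_cancel (Fact.out : p.Prime).one_le, norm_mul, u1, one_mul] at h
      rw [h, norm_mul, norm_mul, norm_pow, norm_pow, norm_neg, norm_one, one_pow, one_mul]
      have hw : ‖gchoose (x + 1) (p - 1)‖ ≤ (p : ℝ)⁻¹ :=
        norm_gchoose_le_inv (by omega) (by omega) hx1
      refine (mul_le_of_le_one_left (by positivity) ?_).trans
        (pow_le_pow_left₀ (norm_nonneg _) hw 2)
      exact norm_recurrence_coeff_le_one hx3 (p - 1)
    have hbin : ‖(x + 2) * gchoose (x + 2) (k + 1) - 4 * (x + 1) * gchoose x k‖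
        ≤ (p : ℝ)⁻¹ ^ 2 := by
      have hk1 : ‖(k : ℚ_[p]) + 1‖ = 1 := by
        exact_mod_cast Padic.norm_natCast_eq_one_of_lt (p := p) (m := k + 1) (by omega) (by omega)
      rw [add_two_mul_gchoose_sub, norm_div, hk1, div_one, norm_mul, norm_pow]
      exact (mul_le_of_le_one_left (by positivity)
        (norm_gchoose_le_one u1.le (by omega))).trans (pow_le_pow_left₀ (norm_nonneg _) hx0 2)
    have key : (x + 2) * (altSumSq (x + 2) p - (-1) ^ (k + 1) * gchoose (x + 2) (k + 1)) =
        ((x + 2) * altSumSq (x + 2) p + 4 * (x + 1) * altSumSq x p) -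
          4 * (x + 1) * (altSumSq x p - (-1) ^ k * gchoose x k) +
          (-1) ^ k * ((x + 2) * gchoose (x + 2) (k + 1) - 4 * (x + 1) * gchoose x k) := by
      ring
    rw [← one_mul ‖altSumSq (x + 2) p - _‖, ← u2, ← norm_mul, key]
    refine Padic.norm_add_le_of_le (Padic.norm_sub_le_of_le hrec ?_) (by simpa using hbin)
    rw [norm_mul, norm_mul, u1, mul_one]
    exact (mul_le_of_le_one_left (norm_nonneg _) four_le).trans (ih (by omega) x hx0)

end Padic

/-- Let `p` be an odd prime and `x ∈ ℤ_p` with `x ≡ 2k (mod p)` for some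
`k ∈ {0, …, (p-1)/2}`. Then `∑_{r=0}^{p-1} (-1)^r C(x,r)² ≡ (-1)^k C(x,k) (mod p²)`
in `ℤ_p`. -/
theorem sum_neg_one_pow_choose_sq (p : ℕ) [Fact p.Prime] (hp2 : p ≠ 2) (x : ℤ_[p])
    (k : ℕ) (hk : k ≤ (p - 1) / 2) (hcong : (p : ℤ_[p]) ∣ x - 2 * k) :
    ∃ z : ℤ_[p],
      (∑ r ∈ Finset.range p, (-1 : ℚ_[p]) ^ r * gchoose (x : ℚ_[p]) r ^ 2) -
        (-1 : ℚ_[p]) ^ k * gchoose (x : ℚ_[p]) k = (p : ℚ_[p]) ^ 2 * z := by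
  have hp : 0 < p := (Fact.out : p.Prime).pos
  have hx : ‖(x : ℚ_[p]) - 2 * k‖ ≤ (p : ℝ)⁻¹ := by
    obtain ⟨c, hc⟩ := hcong
    have h : (x : ℚ_[p]) - 2 * k = p * c := by exact_mod_cast congrArg Subtype.val hc
    rw [h, norm_mul, Padic.norm_p]
    exact mul_le_of_le_one_right (by positivity) c.norm_le_one
  have hmain := norm_altSumSq_sub_le k (by omega) (x : ℚ_[p]) hx
  have hp0 : (p : ℚ_[p]) ^ 2 ≠ 0 := pow_ne_zero _ (Nat.cast_ne_zero.2 hp.ne')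
  refine ⟨⟨(altSumSq (x : ℚ_[p]) p - (-1) ^ k * gchoose (x : ℚ_[p]) k) / (p : ℚ_[p]) ^ 2, ?_⟩,
    (mul_div_cancel₀ _ hp0).symm⟩
  rw [norm_div, norm_pow, Padic.norm_p]
  exact div_le_one_of_le₀ hmain (by positivity)
end

section
/- Let p be an odd prime and let x be a p-adic integer. If x ≡ k (mod p) for some k ∈ {0, 1, …, p-1}, then ∑_{r=0}^{p-1} C(x,r)² ≡ C(2x,k) (mod p²), where the congruence is in the ring ℤ_p of p-adic integers. -/
theorem natCast_dvd_natCast_iff (p : ℕ) [Fact p.Prime] (n : ℕ) :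
    (p : ℤ_[p]) ∣ (n : ℤ_[p]) ↔ p ∣ n := by
  have h := PadicInt.pow_p_dvd_int_iff (p := p) 1 n
  rw [pow_one, pow_one, Int.cast_natCast] at h
  exact h.trans Int.natCast_dvd_natCast

theorem gchoose_eq_coe_choose (p : ℕ) [Fact p.Prime] (x : ℤ_[p]) (r : ℕ) :
    gchoose (x : ℚ_[p]) r = ((Ring.choose x r : ℤ_[p]) : ℚ_[p]) := by
  have h := Ring.descPochhammer_eq_factorial_smul_choose x r
  rw [← Polynomial.aeval_eq_smeval, Polynomial.aeval_def, ← Polynomial.eval_map,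
    descPochhammer_map, descPochhammer_eval_eq_prod_range, nsmul_eq_mul] at h
  rw [gchoose, div_eq_iff (by exact_mod_cast r.factorial_ne_zero), mul_comm]
  have hcoe := congrArg (PadicInt.Coe.ringHom (p := p)) h
  simp only [map_prod, map_mul, map_sub, map_natCast] at hcoe
  exact hcoe

/-- Generalized binomial coefficients below `p` respect congruence modulo `p`. -/
theorem dvd_choose_sub_choose (p : ℕ) [Fact p.Prime] {x y : ℤ_[p]} (h : (p : ℤ_[p]) ∣ x - y)
    {r : ℕ} (hr : r < p) : (p : ℤ_[p]) ∣ Ring.choose x r - Ring.choose y r := by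
  have hfac : ¬ (p : ℤ_[p]) ∣ (r.factorial : ℤ_[p]) := by
    rw [natCast_dvd_natCast_iff, Nat.Prime.dvd_factorial Fact.out]
    lia
  refine (PadicInt.prime_p.dvd_or_dvd ?_).resolve_left hfac
  rw [mul_sub, ← nsmul_eq_mul, ← nsmul_eq_mul, ← Ring.descPochhammer_eq_factorial_smul_choose,
    ← Ring.descPochhammer_eq_factorial_smul_choose, ← Polynomial.aeval_eq_smeval,
    ← Polynomial.aeval_eq_smeval, Polynomial.aeval_def, Polynomial.aeval_def,
    ← Polynomial.eval_map, ← Polynomial.eval_map]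
  exact h.trans (Polynomial.sub_dvd_eval_sub _ _ _)

/-- Twice the difference of a sum of squares and a self-convolution is a sum of squares. -/
theorem two_mul_sum_sq_sub_sum_mul_antidiagonal {R : Type*} [CommRing R] (c : ℕ → R) (k : ℕ) :
    2 * (∑ r ∈ Finset.range (k + 1), c r ^ 2 -
        ∑ ij ∈ Finset.HasAntidiagonal.antidiagonal k, c ij.1 * c ij.2) =
      ∑ ij ∈ Finset.HasAntidiagonal.antidiagonal k, (c ij.1 - c ij.2) ^ 2 := by
  have h1 : ∑ ij ∈ Finset.HasAntidiagonal.antidiagonal k, c ij.1 ^ 2 =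
      ∑ r ∈ Finset.range (k + 1), c r ^ 2 :=
    Finset.Nat.sum_antidiagonal_eq_sum_range_succ (fun i _ => c i ^ 2) k
  have h2 : ∑ ij ∈ Finset.HasAntidiagonal.antidiagonal k, c ij.2 ^ 2 =
      ∑ r ∈ Finset.range (k + 1), c r ^ 2 := by
    rw [← h1]
    exact Finset.Nat.sum_antidiagonal_swap (f := fun ij => c ij.1 ^ 2)
  simp only [sub_sq, Finset.sum_add_distrib, Finset.sum_sub_distrib, h1, h2, mul_assoc,
    ← Finset.mul_sum]
  ring

/-- The congruence of `sum_choose_sq` inside `ℤ_[p]`. -/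
theorem sq_dvd_sum_choose_sq_sub (p : ℕ) [Fact p.Prime] (hp2 : p ≠ 2) (x : ℤ_[p])
    {k : ℕ} (hk : k < p) (hcong : (p : ℤ_[p]) ∣ x - k) :
    (p : ℤ_[p]) ^ 2 ∣
      ∑ r ∈ Finset.range p, Ring.choose x r ^ 2 - Ring.choose (2 * x) k := by
  have hc : ∀ r < p, (p : ℤ_[p]) ∣ Ring.choose x r - (k.choose r : ℤ_[p]) := fun r hr => by
    simpa only [Ring.choose_natCast] using dvd_choose_sub_choose p hcong hr
  have htail : (p : ℤ_[p]) ^ 2 ∣ ∑ r ∈ Finset.Ico (k + 1) p, Ring.choose x r ^ 2 := by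
    refine Finset.dvd_sum fun r hr => pow_dvd_pow_of_dvd ?_ 2
    rw [Finset.mem_Ico] at hr
    simpa [Nat.choose_eq_zero_of_lt (show k < r by lia)] using hc r hr.2
  have hsq : (p : ℤ_[p]) ^ 2 ∣
      ∑ ij ∈ Finset.HasAntidiagonal.antidiagonal k,
        (Ring.choose x ij.1 - Ring.choose x ij.2) ^ 2 := by
    refine Finset.dvd_sum fun ij hij => pow_dvd_pow_of_dvd ?_ 2
    rw [Finset.HasAntidiagonal.mem_antidiagonal] at hij
    have h := dvd_sub (hc ij.1 (by lia)) (hc ij.2 (by lia))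
    rwa [Nat.choose_symm_of_eq_add hij.symm, sub_sub_sub_cancel_right] at h
  have htwo : ¬ (p : ℤ_[p]) ∣ 2 := by
    rw [← Nat.cast_ofNat, natCast_dvd_natCast_iff,
      Nat.prime_dvd_prime_iff_eq Fact.out Nat.prime_two]
    exact hp2
  rw [← two_mul_sum_sq_sub_sum_mul_antidiagonal (fun r => Ring.choose x r)] at hsq
  have hhead := PadicInt.prime_p.pow_dvd_of_dvd_mul_left 2 htwo hsq
  rw [two_mul, Ring.add_choose_eq k (Commute.all x x),
    ← Finset.sum_range_add_sum_Ico _ (show k + 1 ≤ p by lia), add_sub_right_comm]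
  exact dvd_add hhead htail

/-- Let `p` be an odd prime and `x ∈ ℤ_p` with `x ≡ k (mod p)` for some
`k ∈ {0, …, p-1}`. Then `∑_{r=0}^{p-1} C(x,r)² ≡ C(2x,k) (mod p²)` in `ℤ_p`. -/
theorem sum_choose_sq (p : ℕ) [Fact p.Prime] (hp2 : p ≠ 2) (x : ℤ_[p])
    (k : ℕ) (hk : k ≤ p - 1) (hcong : (p : ℤ_[p]) ∣ x - k) :
    ∃ z : ℤ_[p],
      (∑ r ∈ Finset.range p, gchoose (x : ℚ_[p]) r ^ 2) -
        gchoose (2 * (x : ℚ_[p])) k = (p : ℚ_[p]) ^ 2 * z := by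
  have hk' : k < p := by
    have := (Fact.out : p.Prime).pos
    lia
  obtain ⟨z, hz⟩ := sq_dvd_sum_choose_sq_sub p hp2 x hk' hcong
  refine ⟨z, ?_⟩
  have h2 : 2 * (x : ℚ_[p]) = ((2 * x : ℤ_[p]) : ℚ_[p]) := by push_cast; rfl
  have hcoe := congrArg (PadicInt.Coe.ringHom (p := p)) hz
  simp only [map_sum, map_mul, map_sub, map_pow, map_natCast] at hcoe
  simp only [h2, gchoose_eq_coe_choose]
  exact hcoe
end
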